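/- arXiv:1606.06231 — 2 statements merged into one kernel-verified Lean document; each statement's English description precedes it below -/
import Mathlib

section
/- Suppose s > -1 and 1 ≤ p < ∞, let u ∈ D'(ℝ^N) with ∇u ∈ (L^p_s)^N, and suppose that N = 1 or that u is radially symmetric. Fix ρ > 0 and set c_u := |B_ρ|^{-1} ∫_{B_ρ} u. Then u ∈ L^q_{s+1} for every q ∈ I_{1,p}, and for each such q there is a constant C = C(s,p,q) > 0 independent of u such that ||u - c_u||_{L^q_{s+1}} ≤ C ||\,|∇u|\,||_{L^p_s}. Furthermore, if p > N or p = N = 1, then lim_{|x|→∞} |x|^{-(s+1)} u(x) = 0. -/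
open MeasureTheory Metric Filter Topology ENNReal

noncomputable section

/-- Euclidean space `ℝ^N`. -/
abbrev Euc (N : ℕ) := EuclideanSpace ℝ (Fin N)

/-- Iterated classical partial derivative along a list of coordinate directions. -/
def pderivList {N : ℕ} : List (Fin N) → (Euc N → ℝ) → Euc N → ℝ
  | [], φ => φ
  | i :: l, φ => pderivList l fun x => fderiv ℝ φ x (EuclideanSpace.single i 1)

/-- `g` is the weak (distributional) partial derivative of `u` of order given by the
list `l` of coordinate directions, i.e. `g = ∂_{l₁} ⋯ ∂_{l_r} u` in `D'(ℝ^N)`. -/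
def IsWeakDerivList {N : ℕ} (l : List (Fin N)) (u g : Euc N → ℝ) : Prop :=
  LocallyIntegrable u volume ∧ LocallyIntegrable g volume ∧
    ∀ φ : Euc N → ℝ, ContDiff ℝ (⊤ : ℕ∞) φ → HasCompactSupport φ →
      ∫ x, u x * pderivList l φ x = (-1 : ℝ) ^ l.length * ∫ x, g x * φ x

/-- `g` is the weak partial derivative `∂ᵢ u`. -/
def IsWeakPartialDeriv {N : ℕ} (i : Fin N) (u g : Euc N → ℝ) : Prop :=
  IsWeakDerivList [i] u g

/-- The weight `(1+|x|)^{-s-N/q}` of the space `L^q_s` (with `N/∞ := 0`). -/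
def wt (N : ℕ) (s : ℝ) (q : ℝ≥0∞) (x : Euc N) : ℝ :=
  (1 + ‖x‖) ^ (-s - (N : ℝ) / q.toReal)

/-- Membership in the weighted space `L^q_s`. -/
def MemLs (N : ℕ) (s : ℝ) (q : ℝ≥0∞) (u : Euc N → ℝ) : Prop :=
  MemLp (fun x => wt N s q x * u x) q volume

/-- The norm of the weighted space `L^q_s`. -/
def LsNorm (N : ℕ) (s : ℝ) (q : ℝ≥0∞) (u : Euc N → ℝ) : ℝ :=
  (eLpNorm (fun x => wt N s q x * u x) q volume).toReal

/-- Membership in the exponentially weighted space `L^q_{exp,s}`. -/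
def MemLexp (N : ℕ) (s : ℝ) (q : ℝ≥0∞) (u : Euc N → ℝ) : Prop :=
  MemLp (fun x => Real.exp (-(s * ‖x‖)) * u x) q volume

/-- The norm of the exponentially weighted space `L^q_{exp,s}`. -/
def LexpNorm (N : ℕ) (s : ℝ) (q : ℝ≥0∞) (u : Euc N → ℝ) : ℝ :=
  (eLpNorm (fun x => Real.exp (-(s * ‖x‖)) * u x) q volume).toReal

/-- The pointwise Euclidean (Frobenius) norm `|∇^k u|` of the `k`-th gradient, whose
components `g m` are indexed by the `k`-tuples `m` of coordinate directions. -/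
def gradNormK {N k : ℕ} (g : (Fin k → Fin N) → Euc N → ℝ) (x : Euc N) : ℝ :=
  Real.sqrt (∑ m : Fin k → Fin N, g m x ^ 2)

/-- The pointwise Euclidean norm `|∇u|` of a first-order gradient. -/
def gradNorm1 {N : ℕ} (g : Fin N → Euc N → ℝ) (x : Euc N) : ℝ :=
  Real.sqrt (∑ i, g i x ^ 2)

/-- The interval `I_{j,p}` of admissible exponents `q`. -/
def Ijp (N j : ℕ) (p : ℝ) : Set ℝ≥0∞ :=
  if p = (N : ℝ) / (j : ℝ) ∧ 1 < N then Set.Ico (ENNReal.ofReal p) ⊤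
  else if p < (N : ℝ) / (j : ℝ) then
    Set.Icc (ENNReal.ofReal p) (ENNReal.ofReal ((N : ℝ) * p / ((N : ℝ) - (j : ℝ) * p)))
  else Set.Icc (ENNReal.ofReal p) ⊤

/-- The average of `u` on the ball `B_ρ`. -/
def ballAvg {N : ℕ} (ρ : ℝ) (u : Euc N → ℝ) : ℝ :=
  (volume (ball (0 : Euc N) ρ)).toReal⁻¹ * ∫ y in ball (0 : Euc N) ρ, u y

/-- The radial symmetrization `u_S(x) = (Nω_N)⁻¹ ∫_{S^{N-1}} u(|x|σ) dσ`. -/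
def radialSymmetrization {N : ℕ} (u : Euc N → ℝ) (x : Euc N) : ℝ :=
  ((N : ℝ) * (volume (ball (0 : Euc N) 1)).toReal)⁻¹ *
    ∫ σ : sphere (0 : Euc N) 1, u (‖x‖ • (σ : Euc N)) ∂((volume : Measure (Euc N)).toSphere)

/-- `u` is radially symmetric: `u x` only depends on `|x|`. -/
def RadSymm {N : ℕ} (u : Euc N → ℝ) : Prop :=
  ∀ x y : Euc N, ‖x‖ = ‖y‖ → u x = u y

/-- Evaluation of a polynomial on `ℝ^N` at a point. -/
def polyEval {N : ℕ} (π : MvPolynomial (Fin N) ℝ) (x : Euc N) : ℝ :=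
  MvPolynomial.eval (fun i => x i) π


open Set in
lemma aux_int_mul {I : Set ℝ} {w φ : ℝ → ℝ} (hw : LocallyIntegrableOn w I volume)
    (hφ : Continuous φ) (hc : HasCompactSupport φ) (hs : tsupport φ ⊆ I) :
    Integrable (fun t => w t * φ t) volume := by
  have h1 : IntegrableOn (fun t => w t * φ t) (tsupport φ) volume :=
    (hw.integrableOn_compact_subset hs hc).mul_continuousOn hφ.continuousOn hc
  rw [← integrableOn_iff_integrable_of_support_subset (s := tsupport φ)]
  · exact h1
  · intro x hx
    apply subset_tsupport
    simp only [Function.mem_support] at hx ⊢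
    intro h0
    simp [h0] at hx

open Set in
lemma aux_exists_Icc {I K : Set ℝ} (hK : IsCompact K) (hne : K.Nonempty) (hKI : K ⊆ I) :
    ∃ m ∈ I, ∃ M ∈ I, K ⊆ Icc m M := by
  obtain ⟨m, hm⟩ := hK.exists_isLeast hne
  obtain ⟨M, hM⟩ := hK.exists_isGreatest hne
  exact ⟨m, hKI hm.1, M, hKI hM.1, fun x hx => ⟨hm.2 hx, hM.2 hx⟩⟩

open Set in
lemma aux_dbr {I : Set ℝ} (hI : IsOpen I) (hc : I.OrdConnected) (hne : I.Nonempty) (w : ℝ → ℝ)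
    (hw : LocallyIntegrableOn w I volume)
    (h : ∀ ψ : ℝ → ℝ, ContDiff ℝ (⊤ : ℕ∞) ψ → HasCompactSupport ψ → tsupport ψ ⊆ I →
      ∫ t, w t * deriv ψ t = 0) : ∃ a : ℝ, ∀ᵐ t, t ∈ I → w t = a := by
  obtain ⟨c, hcI⟩ := hne
  obtain ⟨ε, hε, hball⟩ := Metric.isOpen_iff.1 hI c hcI
  let B : ContDiffBump c := ⟨ε / 4, ε / 2, by linarith, by linarith⟩
  let θ : ℝ → ℝ := B.normed volume
  have hθi : ∫ t, θ t = 1 := B.integral_normed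
  have hθs : tsupport θ ⊆ I := by
    rw [show tsupport θ = _ from B.tsupport_normed_eq]
    refine Subset.trans (closedBall_subset_ball ?_) hball
    show ε / 2 < ε
    linarith
  have hθc : HasCompactSupport θ := B.hasCompactSupport_normed
  have hθd : ContDiff ℝ (⊤ : ℕ∞) θ := B.contDiff_normed
  refine ⟨∫ t, w t * θ t, ?_⟩
  have key := hI.ae_eq_zero_of_integral_contDiff_smul_eq_zero (μ := volume)
    (f := fun t => w t - ∫ t, w t * θ t) ?_ ?_
  · filter_upwards [key] with t ht hti
    linarith [ht hti]
  · exact hw.sub ((continuous_const (y := ∫ t, w t * θ t)).locallyIntegrable.locallyIntegrableOn I)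
  intro φ hφd hφc hφs
  set J := ∫ t, φ t with hJ
  let η : ℝ → ℝ := fun t => φ t - J * θ t
  have hφint : Integrable φ := hφd.continuous.integrable_of_hasCompactSupport hφc
  have hθint : Integrable θ := hθd.continuous.integrable_of_hasCompactSupport hθc
  have hηint : Integrable η := hφint.sub (hθint.const_mul J)
  have hηi : ∫ t, η t = 0 := by
    simp only [η]
    rw [integral_sub hφint (hθint.const_mul J), integral_const_mul, hθi, ← hJ]; ring
  have hηd : ContDiff ℝ (⊤ : ℕ∞) η := hφd.sub (contDiff_const.mul hθd)
  obtain ⟨m, hm, M, hM, hK⟩ := aux_exists_Icc (I := I) (K := tsupport φ ∪ tsupport θ)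
    (hφc.isCompact.union hθc.isCompact)
    (by
      refine Nonempty.inr ?_
      rw [show tsupport θ = _ from B.tsupport_normed_eq]
      exact ⟨c, mem_closedBall_self (by show 0 ≤ ε / 2; linarith)⟩) (union_subset hφs hθs)
  have hη0 : ∀ t, t ∉ Icc m M → η t = 0 := by
    intro t ht
    have h1 : φ t = 0 := by
      by_contra h0
      exact ht (hK (Or.inl (subset_tsupport _ h0)))
    have h2 : θ t = 0 := by
      by_contra h0
      exact ht (hK (Or.inr (subset_tsupport _ h0)))
    simp [η, h1, h2]
  let ψ : ℝ → ℝ := fun t => ∫ x in m..t, η x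
  have hψd : ∀ t, HasDerivAt ψ (η t) t := fun t =>
    intervalIntegral.integral_hasDerivAt_right (hηint.intervalIntegrable)
      (hηd.continuous.stronglyMeasurableAtFilter _ _) hηd.continuous.continuousAt
  have hψ' : deriv ψ = η := funext fun t => (hψd t).deriv
  have hψ0 : ∀ t, t ∉ Icc m M → ψ t = 0 := by
    intro t ht
    rcases lt_or_ge t m with h1 | h1
    · simp only [ψ]
      rw [intervalIntegral.integral_symm]
      have : ∫ x in t..m, η x = 0 := by
        rw [intervalIntegral.integral_of_le h1.le, ← integral_Ico_eq_integral_Ioc]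
        apply setIntegral_eq_zero_of_forall_eq_zero
        intro x hx
        apply hη0
        intro hx2
        exact absurd hx.2 (not_lt.2 hx2.1)
      rw [this, neg_zero]
    · have h2 : M < t := by
        by_contra h3
        exact ht ⟨h1, not_lt.1 h3⟩
      simp only [ψ]
      rw [intervalIntegral.integral_of_le h1, ← integral_Icc_eq_integral_Ioc,
        setIntegral_eq_integral_of_forall_compl_eq_zero, hηi]
      intro x hx
      apply hη0
      intro hx2
      exact hx ⟨hx2.1, hx2.2.trans h2.le⟩
  have hψs : tsupport ψ ⊆ Icc m M := by
    apply closure_minimal _ isClosed_Icc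
    intro t ht
    by_contra h0
    exact ht (hψ0 t h0)
  have hψc : HasCompactSupport ψ :=
    isCompact_Icc.of_isClosed_subset (isClosed_tsupport _) hψs
  have hψC : ContDiff ℝ (⊤ : ℕ∞) ψ := by
    rw [contDiff_infty_iff_deriv]
    exact ⟨fun t => (hψd t).differentiableAt, by rw [hψ']; exact hηd⟩
  have := h ψ hψC hψc (hψs.trans (hc.out hm hM))
  rw [hψ'] at this
  have e1 := aux_int_mul hw hφd.continuous hφc hφs
  have e2 := aux_int_mul hw hθd.continuous hθc hθs
  have e3 : ∫ t, w t * η t = (∫ t, w t * φ t) - J * ∫ t, w t * θ t := by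
    rw [← integral_const_mul, ← integral_sub e1 (e2.const_mul J)]
    congr 1; ext t; simp only [η]; ring
  rw [e3] at this
  have e4 : ∫ x, φ x • (w x - ∫ t, w t * θ t) = (∫ t, w t * φ t) - J * ∫ t, w t * θ t := by
    rw [hJ, mul_comm, ← integral_const_mul, ← integral_sub e1 (hφint.const_mul _)]
    congr 1; ext t; simp only [smul_eq_mul]; ring
  rw [e4, this]

/-- signed kernel for primitives -/
def auxk (b ρ t : ℝ) : ℝ :=
  (if b < ρ ∧ ρ ≤ t then 1 else 0) - (if t < ρ ∧ ρ ≤ b then 1 else 0)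

lemma auxk_abs (b ρ t : ℝ) : |auxk b ρ t| ≤ 1 := by
  unfold auxk; split_ifs <;> simp

lemma auxk_zero {b ρ t : ℝ} (h : ρ ∉ Set.uIcc b t) : auxk b ρ t = 0 := by
  unfold auxk
  rw [if_neg, if_neg]
  · simp
  · rintro ⟨h1, h2⟩; exact h (Set.mem_uIcc.2 (Or.inr ⟨h1.le, h2⟩))
  · rintro ⟨h1, h2⟩; exact h (Set.mem_uIcc.2 (Or.inl ⟨h1.le, h2⟩))

lemma auxk_meas (b : ℝ) : Measurable (fun z : ℝ × ℝ => auxk b z.1 z.2) := by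
  unfold auxk
  refine Measurable.sub (Measurable.ite ?_ measurable_const measurable_const)
    (Measurable.ite ?_ measurable_const measurable_const)
  · exact (measurableSet_lt measurable_const measurable_fst).inter
      (measurableSet_le measurable_fst measurable_snd)
  · exact (measurableSet_lt measurable_snd measurable_fst).inter
      (measurableSet_le measurable_fst measurable_const)

open Set in
lemma auxk_integral (b ρ : ℝ) {ψ : ℝ → ℝ} (hψ : ContDiff ℝ 1 ψ) (hc : HasCompactSupport ψ) :
    ∫ t, auxk b ρ t * deriv ψ t = - ψ ρ := by
  rcases lt_or_ge b ρ with h | h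
  · have : ∀ t, auxk b ρ t * deriv ψ t = (Ici ρ).indicator (deriv ψ) t := by
      intro t
      by_cases h1 : ρ ≤ t
      · simp [auxk, h, h1, not_lt.2 h1]
      · simp [auxk, h, h1]
    simp_rw [this]
    rw [integral_indicator measurableSet_Ici, integral_Ici_eq_integral_Ioi,
      hc.integral_Ioi_deriv_eq hψ]
  · have : ∀ t, auxk b ρ t * deriv ψ t = - (Iio ρ).indicator (deriv ψ) t := by
      intro t
      by_cases h1 : t < ρ
      · simp [auxk, not_lt.2 h, h1, h]
      · simp [auxk, h1, not_lt.2 h]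
    simp_rw [this]
    rw [integral_neg, integral_indicator measurableSet_Iio, ← integral_Iic_eq_integral_Iio,
      hc.integral_Iic_deriv_eq hψ]

open Set in
lemma aux_prim {X : Type*} [MeasurableSpace X] (μ : Measure X) [SFinite μ] (r : X → ℝ)
    (hr : Measurable r) (G : X → ℝ) {I : Set ℝ} (hI : IsOpen I) (hc : I.OrdConnected) {b : ℝ}
    (hb : b ∈ I) (hG : ∀ m ∈ I, ∀ M ∈ I, IntegrableOn G (r ⁻¹' Icc m M) μ)
    (w : ℝ → ℝ) (hw : LocallyIntegrableOn w I volume)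
    (h : ∀ ψ : ℝ → ℝ, ContDiff ℝ (⊤ : ℕ∞) ψ → HasCompactSupport ψ → tsupport ψ ⊆ I →
      ∫ t, w t * deriv ψ t = - ∫ x, G x * ψ (r x) ∂μ) :
    ∃ a : ℝ, ∀ᵐ t, t ∈ I → ‖w t - a‖ₑ ≤ ∫⁻ x in r ⁻¹' (uIcc b t), ‖G x‖ₑ ∂μ := by
  let F : ℝ → ℝ := fun t => ∫ x, G x * auxk b (r x) t ∂μ
  -- the truncated integrand
  have hF1 : ∀ m ∈ I, ∀ M ∈ I, b ∈ Icc m M → ∀ t ∈ Icc m M, ∀ x,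
      G x * auxk b (r x) t = (r ⁻¹' Icc m M).indicator G x * auxk b (r x) t := by
    intro m _ M _ hbm t ht x
    by_cases hx : x ∈ r ⁻¹' Icc m M
    · rw [indicator_of_mem hx]
    · rw [indicator_of_notMem hx, auxk_zero, mul_zero, zero_mul]
      intro h2
      exact hx (uIcc_subset_Icc hbm ht h2)
  have hkm : Measurable (fun z : X × ℝ => auxk b (r z.1) z.2) :=
    (auxk_meas b).comp ((hr.comp measurable_fst).prodMk measurable_snd)
  have hJ : ∀ (m M : ℝ), m ∈ I → M ∈ I → ∀ (f : ℝ → ℝ) (ν : Measure ℝ) [SFinite ν],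
      Integrable f ν →
      Integrable (fun z : X × ℝ => (r ⁻¹' Icc m M).indicator G z.1 * auxk b (r z.1) z.2 * f z.2)
        (μ.prod ν) := by
    intro m M hm hM f ν _ hf
    have h1 : Integrable ((r ⁻¹' Icc m M).indicator G) μ :=
      (hG m hm M hM).integrable_indicator (hr measurableSet_Icc)
    have h2 := h1.mul_prod hf
    have h3 := h2.bdd_mul (c := 1) (f := fun z : X × ℝ => auxk b (r z.1) z.2)
      hkm.aestronglyMeasurable (Eventually.of_forall fun z => auxk_abs _ _ _)
    refine h3.congr (Eventually.of_forall fun z => ?_)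
    simp only; ring
  have hFint : ∀ m ∈ I, ∀ M ∈ I, b ∈ Icc m M → IntegrableOn F (Icc m M) volume := by
    intro m hm M hM hbm
    have h1 := (hJ m M hm hM (fun _ => 1) (volume.restrict (Icc m M))
      (integrable_const _)).integral_prod_right
    refine h1.congr ?_
    filter_upwards [ae_restrict_mem measurableSet_Icc] with t ht
    simp only [F, mul_one]
    refine integral_congr_ae (Eventually.of_forall fun x => ?_)
    exact (hF1 m hm M hM hbm t ht x).symm
  have hIcc : ∀ K ⊆ I, IsCompact K → ∃ m ∈ I, ∃ M ∈ I, b ∈ Icc m M ∧ K ⊆ Icc m M := by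
    intro K hK hKc
    obtain ⟨m, hm, M, hM, hh⟩ := aux_exists_Icc (I := I) (K := K ∪ {b})
      (hKc.union isCompact_singleton) ⟨b, Or.inr rfl⟩
      (union_subset hK (singleton_subset_iff.2 hb))
    exact ⟨m, hm, M, hM, hh (Or.inr rfl), fun x hx => hh (Or.inl hx)⟩
  have hFloc : LocallyIntegrableOn F I volume := by
    rw [locallyIntegrableOn_iff hI.isLocallyClosed]
    intro K hK hKc
    obtain ⟨m, hm, M, hM, hbm, hKm⟩ := hIcc K hK hKc
    exact (hFint m hm M hM hbm).mono_set hKm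
  obtain ⟨a, ha⟩ := aux_dbr hI hc ⟨b, hb⟩ (fun t => w t - F t) (hw.sub hFloc) (by
    intro ψ hψ hψc hψs
    have hdc : Continuous (deriv ψ) := hψ.continuous_deriv (by simp)
    have hds : tsupport (deriv ψ) ⊆ I := (tsupport_deriv_subset (𝕜 := ℝ)).trans hψs
    have hdcs : HasCompactSupport (deriv ψ) := hψc.deriv
    have e1 := aux_int_mul hw hdc hdcs hds
    have e2 := aux_int_mul hFloc hdc hdcs hds
    simp_rw [sub_mul]
    rw [integral_sub e1 e2, h ψ hψ hψc hψs]
    obtain ⟨m, hm, M, hM, hbm, hKm⟩ := hIcc _ hψs hψc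
    have hJ1 := hJ m M hm hM (deriv ψ) volume (hdc.integrable_of_hasCompactSupport hdcs)
    have e3 : ∀ t x, G x * auxk b (r x) t * deriv ψ t
        = (r ⁻¹' Icc m M).indicator G x * auxk b (r x) t * deriv ψ t := by
      intro t x
      by_cases ht : t ∈ Icc m M
      · rw [hF1 m hm M hM hbm t ht x]
      · have : deriv ψ t = 0 := by
          by_contra h0
          exact ht (hKm (tsupport_deriv_subset (𝕜 := ℝ) (subset_tsupport _ h0)))
        simp [this]
    have e4 : ∫ t, F t * deriv ψ t = ∫ x, - (G x * ψ (r x)) ∂μ := by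
      calc ∫ t, F t * deriv ψ t
          = ∫ t, ∫ x, (r ⁻¹' Icc m M).indicator G x * auxk b (r x) t * deriv ψ t ∂μ := by
            congr 1; ext t
            simp only [F]
            rw [← integral_mul_const]
            congr 1; ext x; exact e3 t x
        _ = ∫ x, (∫ t, (r ⁻¹' Icc m M).indicator G x * auxk b (r x) t * deriv ψ t) ∂μ :=
            (integral_integral_swap hJ1).symm
        _ = _ := by
            congr 1; ext x
            simp_rw [← e3, mul_assoc]
            rw [integral_const_mul, auxk_integral _ _ (hψ.of_le (by simp)) hψc]; ring
    rw [e4, integral_neg]; ring)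
  refine ⟨a, ?_⟩
  filter_upwards [ha] with t ht hti
  have e : w t - a = F t := by linarith [ht hti]
  rw [e]
  refine (enorm_integral_le_lintegral_enorm _).trans ?_
  rw [← lintegral_indicator (hr measurableSet_uIcc)]
  refine lintegral_mono fun x => ?_
  by_cases hx : x ∈ r ⁻¹' uIcc b t
  · rw [indicator_of_mem hx, enorm_mul]
    have : ‖auxk b (r x) t‖ₑ ≤ 1 := by
      rw [← ofReal_norm]
      simpa using auxk_abs b (r x) t
    exact mul_le_of_le_one_right' this
  · rw [indicator_of_notMem hx, auxk_zero hx]; simp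

open Set in
lemma aux_polar {N : ℕ} (hN : 1 ≤ N) (f : ℝ → ℝ≥0∞) (hf : Measurable f) :
    ∫⁻ x : Euc N, f ‖x‖ = (volume : Measure (Euc N)).toSphere univ *
      ∫⁻ y in Ioi (0 : ℝ), ENNReal.ofReal (y ^ (N - 1)) * f y := by
  have : Nonempty (Fin N) := ⟨⟨0, hN⟩⟩
  have hfin : Module.finrank ℝ (Euc N) = N := by simp
  calc ∫⁻ x : Euc N, f ‖x‖
      = ∫⁻ x : ({(0)}ᶜ : Set (Euc N)), f (‖x.1‖) ∂((volume : Measure (Euc N)).comap (↑)) := by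
        rw [lintegral_subtype_comap (measurableSet_singleton _).compl fun x => f (‖x‖),
          restrict_compl_singleton]
    _ = ∫⁻ x, f x.2 ∂((volume : Measure (Euc N)).toSphere.prod (.volumeIoiPow (N - 1))) := by
        have := (volume : Measure (Euc N)).measurePreserving_homeomorphUnitSphereProd.lintegral_comp_emb
          (Homeomorph.measurableEmbedding _) (f ∘ Subtype.val ∘ Prod.snd)
        rw [hfin] at this
        simpa using this
    _ = _ := by
        rw [lintegral_prod _ (by fun_prop)]
        simp only [lintegral_const]
        rw [mul_comm]
        congr 1
        rw [Measure.volumeIoiPow, lintegral_withDensity_eq_lintegral_mul _ (by fun_prop) (by fun_prop)]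
        simp only [Pi.mul_apply]
        exact lintegral_subtype_comap measurableSet_Ioi
          (fun y : ℝ => ENNReal.ofReal (y ^ (N - 1)) * f y)

open Set in
lemma aux_ae_norm {N : ℕ} (hN : 1 ≤ N) {P : ℝ → Prop} (h : ∀ᵐ t : ℝ, t ∈ Ioi (0 : ℝ) → P t) :
    ∀ᵐ x : Euc N, 0 < ‖x‖ → P ‖x‖ := by
  set S := {t : ℝ | ¬ (t ∈ Ioi (0 : ℝ) → P t)} with hS
  have hS0 : volume (toMeasurable volume S) = 0 := by
    rw [measure_toMeasurable]; exact h
  have hm := measurableSet_toMeasurable (volume : Measure ℝ) S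
  have := aux_polar hN ((toMeasurable volume S).indicator 1) (measurable_one.indicator hm)
  have h0 : ∫⁻ y in Ioi (0 : ℝ), ENNReal.ofReal (y ^ (N - 1)) *
      (toMeasurable volume S).indicator 1 y = 0 := by
    refine (lintegral_congr_ae ?_).trans lintegral_zero
    have : ∀ᵐ y : ℝ, y ∉ toMeasurable volume S := by
      rw [ae_iff]; simpa using hS0
    filter_upwards [ae_restrict_of_ae this] with y hy
    simp [hy]
  rw [h0, mul_zero] at this
  have hm2 : Measurable fun x : Euc N =>
      (toMeasurable volume S).indicator (1 : ℝ → ℝ≥0∞) ‖x‖ :=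
    (measurable_one.indicator hm).comp measurable_norm
  rw [lintegral_eq_zero_iff hm2] at this
  filter_upwards [this] with x hx hpos
  by_contra hP
  have : ‖x‖ ∈ toMeasurable volume S := subset_toMeasurable _ _ (by simp [hS, hpos, hP])
  simp [this] at hx

/-- the measure `|y|^{-N} dy` -/
def muN (N : ℕ) : Measure (Euc N) :=
  volume.withDensity fun y => ENNReal.ofReal (‖y‖ ^ (-(N : ℝ)))

instance (N : ℕ) : SFinite (muN N) := by unfold muN; infer_instance

lemma lintegral_muN {N : ℕ} (f : Euc N → ℝ≥0∞) (hf : Measurable f) :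
    ∫⁻ y, f y ∂(muN N) = ∫⁻ y, ENNReal.ofReal (‖y‖ ^ (-(N : ℝ))) * f y := by
  unfold muN
  rw [lintegral_withDensity_eq_lintegral_mul _ (by fun_prop) hf]
  rfl

/-- Hardy kernel -/
def hk {N : ℕ} (β : ℝ) (x y : Euc N) : ℝ≥0∞ :=
  if 0 < ‖y‖ ∧ ‖y‖ ≤ ‖x‖ then ENNReal.ofReal ((‖y‖ / ‖x‖) ^ β) else 0

lemma hk_meas {N : ℕ} (β : ℝ) : Measurable (fun z : Euc N × Euc N => hk β z.1 z.2) := by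
  unfold hk
  refine Measurable.ite ?_ (by fun_prop) measurable_const
  exact (measurableSet_lt measurable_const measurable_snd.norm).inter
    (measurableSet_le measurable_snd.norm measurable_fst.norm)

lemma hk_le_one {N : ℕ} {β : ℝ} (hβ : 0 < β) (x y : Euc N) : hk β x y ≤ 1 := by
  unfold hk
  split_ifs with h
  · rw [ENNReal.ofReal_le_one]
    exact Real.rpow_le_one (by positivity) (div_le_one_of_le₀ h.2 (norm_nonneg _)) hβ.le
  · simp

/-- the constant of the kernel -/
def hA (N : ℕ) (β : ℝ) : ℝ≥0∞ :=
  (volume : Measure (Euc N)).toSphere Set.univ * ENNReal.ofReal (1 / β)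

lemma hA_ne_top (N : ℕ) (β : ℝ) : hA N β ≠ ∞ :=
  ENNReal.mul_ne_top (measure_ne_top _ _) ENNReal.ofReal_ne_top

lemma aux_pow_mul {N : ℕ} (hN : 1 ≤ N) {t : ℝ} (ht : 0 < t) :
    t ^ (N - 1) * t ^ (-(N : ℝ)) = t ^ (-1 : ℝ) := by
  rw [← Real.rpow_natCast, ← Real.rpow_add ht]
  congr 1
  rw [Nat.cast_sub hN]; push_cast; ring

open Set in
lemma hk_int_right {N : ℕ} (hN : 1 ≤ N) {β : ℝ} (hβ : 0 < β) (x : Euc N) :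
    ∫⁻ y, hk β x y ∂(muN N) ≤ hA N β := by
  have hmm : Measurable fun y => hk β x y := Measurable.comp (g := fun z : Euc N × Euc N => hk β z.1 z.2)
    (f := fun y => (x, y)) (hk_meas β) (by fun_prop)
  rw [lintegral_muN _ hmm]
  set R := ‖x‖ with hR
  rcases (norm_nonneg x).eq_or_lt with h0 | h0
  · rw [← hR] at h0
    have : ∀ y : Euc N, hk β x y = 0 := by
      intro y; unfold hk; rw [if_neg]; rintro ⟨h1, h2⟩; rw [← hR, ← h0] at h2; linarith
    simp [this]
  rw [← hR] at h0
  let f : ℝ → ℝ≥0∞ := fun t => ENNReal.ofReal (t ^ (-(N : ℝ))) *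
    (if 0 < t ∧ t ≤ R then ENNReal.ofReal ((t / R) ^ β) else 0)
  have hf : Measurable f := by
    refine Measurable.mul (by fun_prop) (Measurable.ite ?_ (by fun_prop) measurable_const)
    exact (measurableSet_lt measurable_const measurable_id).inter
      (measurableSet_le measurable_id measurable_const)
  refine (aux_polar hN f hf).le.trans ?_
  unfold hA
  gcongr
  have e : ∀ t ∈ Ioi (0 : ℝ), ENNReal.ofReal (t ^ (N - 1)) * f t =
      (Ioc 0 R).indicator (fun t => ENNReal.ofReal (R ^ (-β) * t ^ (β - 1))) t := by
    intro t ht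
    have ht' : 0 < t := ht
    by_cases h1 : t ≤ R
    · rw [indicator_of_mem (show t ∈ Ioc 0 R from ⟨ht', h1⟩)]
      simp only [f, ht', h1, and_self, if_true]
      rw [← ENNReal.ofReal_mul (by positivity), ← ENNReal.ofReal_mul (by positivity), ← mul_assoc,
        aux_pow_mul hN ht', Real.div_rpow ht'.le h0.le, Real.rpow_neg h0.le,
        Real.rpow_sub_one ht'.ne', Real.rpow_neg_one]
      congr 1
      field_simp
    · rw [indicator_of_notMem (show t ∉ Ioc 0 R from fun h => h1 h.2)]
      simp [f, h1]
  rw [setLIntegral_congr_fun measurableSet_Ioi e, lintegral_indicator measurableSet_Ioc,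
    Measure.restrict_restrict measurableSet_Ioc]
  have e2 : Ioc 0 R ∩ Ioi (0 : ℝ) = Ioc 0 R := inter_eq_left.2 fun t ht => ht.1
  rw [e2, ← ofReal_integral_eq_lintegral_ofReal]
  · apply ENNReal.ofReal_le_ofReal
    rw [← intervalIntegral.integral_of_le h0.le, intervalIntegral.integral_const_mul,
      integral_rpow (Or.inl (by linarith))]
    simp only [sub_add_cancel, Real.zero_rpow hβ.ne', sub_zero]
    rw [Real.rpow_neg h0.le]
    have : R ^ β ≠ 0 := by positivity
    field_simp; rfl
  · have := (intervalIntegral.intervalIntegrable_rpow' (a := 0) (b := R) (r := β - 1) (by linarith)).const_mul (R ^ (-β))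
    rwa [intervalIntegrable_iff_integrableOn_Ioc_of_le h0.le] at this
  · filter_upwards [ae_restrict_mem measurableSet_Ioc] with t ht
    have := ht.1
    show 0 ≤ R ^ (-β) * t ^ (β - 1)
    positivity

open Set in
lemma hk_int_left {N : ℕ} (hN : 1 ≤ N) {β : ℝ} (hβ : 0 < β) (y : Euc N) :
    ∫⁻ x, hk β x y ∂(muN N) ≤ hA N β := by
  have hmm : Measurable fun x => hk β x y := Measurable.comp (g := fun z : Euc N × Euc N => hk β z.1 z.2)
    (f := fun x => (x, y)) (hk_meas β) (by fun_prop)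
  rw [lintegral_muN _ hmm]
  set R := ‖y‖ with hR
  rcases (norm_nonneg y).eq_or_lt with h0 | h0
  · rw [← hR] at h0
    have : ∀ x : Euc N, hk β x y = 0 := by
      intro x; unfold hk; rw [if_neg]; rintro ⟨h1, h2⟩; rw [← hR, ← h0] at h1; linarith
    simp [this]
  rw [← hR] at h0
  let f : ℝ → ℝ≥0∞ := fun t => ENNReal.ofReal (t ^ (-(N : ℝ))) *
    (if 0 < R ∧ R ≤ t then ENNReal.ofReal ((R / t) ^ β) else 0)
  have hf : Measurable f := by
    refine Measurable.mul (by fun_prop) (Measurable.ite ?_ (by fun_prop) measurable_const)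
    exact (MeasurableSet.const _).inter (measurableSet_le measurable_const measurable_id)
  refine (aux_polar hN f hf).le.trans ?_
  unfold hA
  gcongr
  have e : ∀ t ∈ Ioi (0 : ℝ), ENNReal.ofReal (t ^ (N - 1)) * f t =
      (Ici R).indicator (fun t => ENNReal.ofReal (R ^ β * t ^ (-β - 1))) t := by
    intro t ht
    have ht' : 0 < t := ht
    by_cases h1 : R ≤ t
    · rw [indicator_of_mem (show t ∈ Ici R from h1)]
      simp only [f, h0, h1, and_self, if_true]
      rw [← ENNReal.ofReal_mul (by positivity), ← ENNReal.ofReal_mul (by positivity), ← mul_assoc,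
        aux_pow_mul hN ht', Real.div_rpow h0.le ht'.le, 
        Real.rpow_sub_one ht'.ne', Real.rpow_neg_one, Real.rpow_neg ht'.le]
      congr 1
      field_simp
    · rw [indicator_of_notMem (show t ∉ Ici R from fun h => h1 h)]
      simp [f, h1]
  rw [setLIntegral_congr_fun measurableSet_Ioi e, lintegral_indicator measurableSet_Ici,
    Measure.restrict_restrict measurableSet_Ici]
  have e2 : Ici R ∩ Ioi (0 : ℝ) = Ici R := inter_eq_left.2 fun t ht => h0.trans_le ht
  rw [e2, ← ofReal_integral_eq_lintegral_ofReal]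
  · apply ENNReal.ofReal_le_ofReal
    rw [integral_Ici_eq_integral_Ioi, integral_const_mul, integral_Ioi_rpow_of_lt (by linarith) h0]
    simp only [sub_add_cancel]
    rw [Real.rpow_neg h0.le]
    have : R ^ β ≠ 0 := by positivity
    field_simp; rfl
  · have := ((integrableOn_Ioi_rpow_of_lt (a := -β - 1) (by linarith) h0).const_mul (R ^ β))
    exact (integrableOn_Ici_iff_integrableOn_Ioi enorm_ne_top).2 this
  · filter_upwards [ae_restrict_mem measurableSet_Ici] with t ht
    have : 0 < t := h0.trans_le ht
    show 0 ≤ R ^ β * t ^ (-β - 1)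
    positivity

section schur
variable {X : Type*} [MeasurableSpace X] (μ : Measure X) [SFinite μ] (k : X → X → ℝ≥0∞)

lemma schur1 (hk : Measurable fun z : X × X => k z.1 z.2) (h1 : ∀ x y, k x y ≤ 1)
    (A : ℝ≥0∞) (hA : ∀ x, ∫⁻ y, k x y ∂μ ≤ A) (F : X → ℝ≥0∞) (hF : Measurable F)
    (p : ℝ) (hp : 1 ≤ p) (x : X) :
    (∫⁻ y, k x y * F y ∂μ) ^ p ≤ A ^ (p - 1) * ∫⁻ y, k x y * F y ^ p ∂μ := by
  have hp0 : 0 < p := by linarith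
  have hkx : Measurable (k x) := hk.comp measurable_prodMk_left
  have h := ENNReal.lintegral_mul_norm_pow_le (μ := μ) (f := k x) (g := fun y => k x y * F y ^ p)
    (p := 1 - 1 / p) (q := 1 / p) hkx.aemeasurable
    (hkx.mul (hF.pow_const p)).aemeasurable
    (by rw [sub_nonneg, div_le_one hp0]; exact hp) (by positivity) (by ring)
  have e : ∀ y, k x y ^ (1 - 1 / p) * (k x y * F y ^ p) ^ (1 / p) = k x y * F y := by
    intro y
    rw [ENNReal.mul_rpow_of_nonneg _ _ (by positivity), ← mul_assoc,
      ← ENNReal.rpow_add_of_nonneg _ _ (by rw [sub_nonneg, div_le_one hp0]; exact hp)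
        (by positivity), ← ENNReal.rpow_mul, mul_one_div_cancel hp0.ne']
    simp
  simp_rw [e] at h
  calc (∫⁻ y, k x y * F y ∂μ) ^ p
      ≤ ((∫⁻ y, k x y ∂μ) ^ (1 - 1 / p) * (∫⁻ y, k x y * F y ^ p ∂μ) ^ (1 / p)) ^ p := by gcongr
    _ = (∫⁻ y, k x y ∂μ) ^ (p - 1) * (∫⁻ y, k x y * F y ^ p ∂μ) := by
        rw [ENNReal.mul_rpow_of_nonneg _ _ hp0.le, ← ENNReal.rpow_mul, ← ENNReal.rpow_mul,
          one_div_mul_cancel hp0.ne', ENNReal.rpow_one]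
        congr 2; field_simp
    _ ≤ _ := by
        exact mul_le_mul' (ENNReal.rpow_le_rpow (hA x) (by linarith)) le_rfl

lemma schur2 (hk : Measurable fun z : X × X => k z.1 z.2) (h1 : ∀ x y, k x y ≤ 1)
    (A : ℝ≥0∞) (hA : ∀ x, ∫⁻ y, k x y ∂μ ≤ A) (F : X → ℝ≥0∞) (hF : Measurable F)
    (p : ℝ) (hp : 1 ≤ p) (x : X) :
    (∫⁻ y, k x y * F y ∂μ) ≤ A ^ ((p - 1) / p) * (∫⁻ y, F y ^ p ∂μ) ^ (1 / p) := by
  have hp0 : 0 < p := by linarith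
  have h := schur1 μ k hk h1 A hA F hF p hp x
  have h2 : ∫⁻ y, k x y * F y ^ p ∂μ ≤ ∫⁻ y, F y ^ p ∂μ :=
    lintegral_mono fun y => mul_le_of_le_one_left' (h1 x y)
  have h3 : (∫⁻ y, k x y * F y ∂μ) ^ p ≤ A ^ (p - 1) * ∫⁻ y, F y ^ p ∂μ :=
    h.trans (by gcongr)
  have h4 := ENNReal.rpow_le_rpow h3 (z := 1 / p) (by positivity)
  rwa [← ENNReal.rpow_mul, mul_one_div_cancel hp0.ne', ENNReal.rpow_one,
    ENNReal.mul_rpow_of_nonneg _ _ (by positivity), ← ENNReal.rpow_mul, mul_one_div] at h4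

lemma schur3 (hk : Measurable fun z : X × X => k z.1 z.2) (h1 : ∀ x y, k x y ≤ 1)
    (A : ℝ≥0∞) (hA : ∀ x, ∫⁻ y, k x y ∂μ ≤ A) (hB : ∀ y, ∫⁻ x, k x y ∂μ ≤ A)
    (F : X → ℝ≥0∞) (hF : Measurable F)
    (p q : ℝ) (hp : 1 ≤ p) (hpq : p ≤ q) :
    (∫⁻ x, (∫⁻ y, k x y * F y ∂μ) ^ q ∂μ) ^ (1 / q) ≤
      A ^ (((p - 1) / p * (q - p) + p) / q) * (∫⁻ y, F y ^ p ∂μ) ^ (1 / p) := by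
  have hp0 : 0 < p := by linarith
  have hq0 : 0 < q := by linarith
  set Φ := ∫⁻ y, F y ^ p ∂μ with hΦ
  have hqp : 0 ≤ q - p := by linarith
  have hpp : 0 ≤ p - 1 := by linarith
  have step : ∫⁻ x, (∫⁻ y, k x y * F y ∂μ) ^ q ∂μ ≤
      (A ^ ((p - 1) / p) * Φ ^ (1 / p)) ^ (q - p) * (A ^ (p - 1) * (A * Φ)) := by
    calc ∫⁻ x, (∫⁻ y, k x y * F y ∂μ) ^ q ∂μ
        ≤ ∫⁻ x, (A ^ ((p - 1) / p) * Φ ^ (1 / p)) ^ (q - p) *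
            (A ^ (p - 1) * ∫⁻ y, k x y * F y ^ p ∂μ) ∂μ := by
          refine lintegral_mono fun x => ?_
          have : (∫⁻ y, k x y * F y ∂μ) ^ q =
              (∫⁻ y, k x y * F y ∂μ) ^ (q - p) * (∫⁻ y, k x y * F y ∂μ) ^ p := by
            rw [← ENNReal.rpow_add_of_nonneg _ _ hqp hp0.le]; congr 1; ring
          simp only
          rw [this]
          exact mul_le_mul' (ENNReal.rpow_le_rpow (schur2 μ k hk h1 A hA F hF p hp x) hqp)
            (schur1 μ k hk h1 A hA F hF p hp x)
      _ = (A ^ ((p - 1) / p) * Φ ^ (1 / p)) ^ (q - p) *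
            (A ^ (p - 1) * ∫⁻ x, ∫⁻ y, k x y * F y ^ p ∂μ ∂μ) := by
          have hm : Measurable fun x => ∫⁻ y, k x y * F y ^ p ∂μ :=
            Measurable.lintegral_prod_right (f := fun x y => k x y * F y ^ p)
              (hk.mul ((hF.comp measurable_snd).pow_const p))
          rw [lintegral_const_mul _ (hm.const_mul _), lintegral_const_mul _ hm]
      _ ≤ _ := by
          gcongr
          rw [lintegral_lintegral_swap
            (hk.mul ((hF.comp measurable_snd).pow_const p)).aemeasurable]
          rw [hΦ, ← lintegral_const_mul _ (hF.pow_const p)]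
          refine lintegral_mono fun y => ?_
          simp only
          have hm : Measurable fun x => k x y := hk.comp measurable_prodMk_right
          rw [lintegral_mul_const _ hm]
          gcongr
          exact hB y
  have h4 := ENNReal.rpow_le_rpow step (z := 1 / q) (by positivity)
  refine h4.trans (le_of_eq ?_)
  have e1 : A ^ (p - 1) * (A * Φ) = A ^ p * Φ := by
    rw [← mul_assoc]; congr 1
    nth_rewrite 2 [← ENNReal.rpow_one A]
    rw [← ENNReal.rpow_add_of_nonneg _ _ hpp (by norm_num)]; congr 1; ring
  rw [e1, ENNReal.mul_rpow_of_nonneg _ _ hqp, ← ENNReal.rpow_mul, ← ENNReal.rpow_mul]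
  have e2 : A ^ ((p - 1) / p * (q - p)) * Φ ^ (1 / p * (q - p)) * (A ^ p * Φ) =
      A ^ ((p - 1) / p * (q - p) + p) * Φ ^ (q / p) := by
    rw [ENNReal.rpow_add_of_nonneg _ _ (by positivity) hp0.le]
    have : Φ ^ (q / p) = Φ ^ (1 / p * (q - p)) * Φ := by
      nth_rewrite 3 [← ENNReal.rpow_one Φ]
      rw [← ENNReal.rpow_add_of_nonneg _ _ (by positivity) (by norm_num)]
      congr 1; field_simp; ring
    rw [this]; ring
  rw [e2, ENNReal.mul_rpow_of_nonneg _ _ (by positivity), ← ENNReal.rpow_mul, ← ENNReal.rpow_mul]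
  congr 2
  · ring
  · field_simp
end schur

lemma aux_norm_deriv {N : ℕ} {x : Euc N} (hx : x ≠ 0) :
    HasFDerivAt (fun y : Euc N => ‖y‖) (‖x‖⁻¹ • innerSL ℝ x) x := by
  have h := (hasStrictFDerivAt_norm_sq x).hasFDerivAt.sqrt (by simpa using hx)
  have e : (fun y : Euc N => √(‖y‖ ^ 2)) = fun y => ‖y‖ := by
    ext y; exact Real.sqrt_sq (norm_nonneg _)
  rw [e, Real.sqrt_sq (norm_nonneg _)] at h
  have hx' : ‖x‖ ≠ 0 := by simpa using hx
  refine h.congr_fderiv ?_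
  ext v
  simp only [_root_.smul_apply, two_smul, _root_.add_apply, smul_eq_mul]
  field_simp
  ring

/-- radial test field -/
def tf {N : ℕ} (ψ : ℝ → ℝ) (i : Fin N) (x : Euc N) : ℝ := ψ ‖x‖ * (‖x‖ ^ N)⁻¹ * x i

lemma tf_zero {N : ℕ} {ψ : ℝ → ℝ} (hs : tsupport ψ ⊆ Set.Ioi 0) (i : Fin N) : tf ψ i =ᶠ[𝓝 (0 : Euc N)] fun _ => 0 := by
  have h0 : (0 : ℝ) ∉ tsupport ψ := fun h => lt_irrefl (0 : ℝ) (Set.mem_Ioi.1 (hs h))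
  have h1 : ∀ᶠ t in 𝓝 (0 : ℝ), t ∉ tsupport ψ :=
    (isClosed_tsupport ψ).isOpen_compl.mem_nhds h0
  have h2 : Tendsto (fun x : Euc N => ‖x‖) (𝓝 0) (𝓝 0) := by
    simpa using (continuous_norm (E := Euc N)).tendsto 0
  filter_upwards [h2.eventually h1] with x hx
  simp [tf, image_eq_zero_of_notMem_tsupport hx]

lemma tf_contDiff {N : ℕ} {ψ : ℝ → ℝ} (hψ : ContDiff ℝ (⊤ : ℕ∞) ψ) (hs : tsupport ψ ⊆ Set.Ioi 0) 
    (i : Fin N) : ContDiff ℝ (⊤ : ℕ∞) (tf ψ i : Euc N → ℝ) := by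
  rw [contDiff_iff_contDiffAt]
  intro x
  by_cases hx : x = 0
  · subst hx
    exact contDiffAt_const.congr_of_eventuallyEq (tf_zero hs i)
  · have hn : ContDiffAt ℝ (⊤ : ℕ∞) (fun y : Euc N => ‖y‖) x := contDiffAt_norm ℝ hx
    have hp : ContDiffAt ℝ (⊤ : ℕ∞) (fun y : Euc N => (‖y‖ ^ N)⁻¹) x :=
      (hn.pow N).inv (by simp [hx])
    have hi : ContDiffAt ℝ (⊤ : ℕ∞) (fun y : Euc N => y i) x :=
      (EuclideanSpace.proj (𝕜 := ℝ) i).contDiff.contDiffAt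
    exact ((hψ.contDiffAt.comp x hn).mul hp).mul hi

lemma tf_compact {N : ℕ} {ψ : ℝ → ℝ} (hc : HasCompactSupport ψ) 
    (i : Fin N) : HasCompactSupport (tf ψ i : Euc N → ℝ) := by
  obtain ⟨R, hR⟩ := hc.isCompact.isBounded.subset_closedBall 0
  refine HasCompactSupport.of_support_subset_isCompact (isCompact_closedBall (0 : Euc N) R) ?_
  intro x hx
  have h1 : ψ ‖x‖ ≠ 0 := by
    intro h0; simp [tf, h0] at hx
  have := hR (subset_tsupport _ h1)
  simpa using this

lemma tf_div {N : ℕ} {ψ : ℝ → ℝ} (hψ : ContDiff ℝ (⊤ : ℕ∞) ψ) (hs : tsupport ψ ⊆ Set.Ioi 0) 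
    (hN : 1 ≤ N) (x : Euc N) :
    ∑ i, fderiv ℝ (tf ψ i) x (EuclideanSpace.single i 1) = deriv ψ ‖x‖ * (‖x‖ ^ (N - 1))⁻¹ := by
  by_cases hx : x = 0
  · have h0 : (0 : ℝ) ∉ tsupport (deriv ψ) :=
      fun h => lt_irrefl (0 : ℝ) (Set.mem_Ioi.1 (hs (tsupport_deriv_subset (𝕜 := ℝ) h)))
    have : ∀ i, fderiv ℝ (tf ψ i) x = 0 := by
      intro i
      rw [hx, (tf_zero hs i).fderiv_eq]; simp
    simp only [this]
    rw [hx, norm_zero, image_eq_zero_of_notMem_tsupport h0]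
    simp
  · have hx' : ‖x‖ ≠ 0 := by simpa using hx
    have hn := aux_norm_deriv hx
    have hψ1 : HasDerivAt ψ (deriv ψ ‖x‖) ‖x‖ :=
      (hψ.differentiable (by simp) _).hasDerivAt
    have hinv : HasDerivAt (fun t : ℝ => (t ^ N)⁻¹) (-(N * ‖x‖ ^ (N - 1)) / (‖x‖ ^ N) ^ 2) ‖x‖ :=
      (hasDerivAt_pow N ‖x‖).inv (by positivity)
    have hχ := (hψ1.mul hinv).comp_hasFDerivAt x hn
    have key : ∀ i, fderiv ℝ (tf ψ i) x (EuclideanSpace.single i 1) =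
        ψ ‖x‖ * (‖x‖ ^ N)⁻¹ + x i ^ 2 * ‖x‖⁻¹ * (deriv ψ ‖x‖ * (‖x‖ ^ N)⁻¹ + ψ ‖x‖ *
          (-(N * ‖x‖ ^ (N - 1)) / (‖x‖ ^ N) ^ 2)) := by
      intro i
      have hi : HasFDerivAt (fun y : Euc N => y i) (EuclideanSpace.proj (𝕜 := ℝ) i) x :=
        (EuclideanSpace.proj (𝕜 := ℝ) i).hasFDerivAt
      have := (hχ.mul hi).fderiv
      have e : tf ψ i = (((ψ * fun t : ℝ => (t ^ N)⁻¹) ∘ fun y : Euc N => ‖y‖) * fun y : Euc N => y i) := by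
        ext y; simp [tf]
      rw [e, this]
      simp [EuclideanSpace.inner_single_right]
      ring
    simp_rw [key]
    rw [Finset.sum_add_distrib, ← Finset.sum_mul, ← Finset.sum_mul, ← Finset.sum_mul]
    have hsq : ∑ i, x i ^ 2 = ‖x‖ ^ 2 := by
      rw [EuclideanSpace.norm_sq_eq]; simp
    rw [hsq]
    obtain ⟨n, rfl⟩ : ∃ n, N = n + 1 := ⟨N - 1, by omega⟩
    simp
    field_simp
    ring

/-- outer part -/
def Tout {N : ℕ} (D : Euc N → ℝ≥0∞) (x : Euc N) : ℝ≥0∞ :=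
  ∫⁻ y in {y | 1 ≤ ‖y‖ ∧ ‖y‖ ≤ ‖x‖}, D y * ENNReal.ofReal (‖y‖ ^ (1 - (N : ℝ)))

/-- inner part -/
def Tin {N : ℕ} (D : Euc N → ℝ≥0∞) (x : Euc N) : ℝ≥0∞ :=
  ∫⁻ y in {y | ‖x‖ ≤ ‖y‖ ∧ ‖y‖ ≤ 1}, D y * ENNReal.ofReal (‖y‖ ^ (1 - (N : ℝ)))

/-- ball part -/
def Bin {N : ℕ} (D : Euc N → ℝ≥0∞) : ℝ≥0∞ := ∫⁻ y in {y : Euc N | ‖y‖ ≤ 1}, D y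

/-- modulus of the gradient -/
def Dg {N : ℕ} (g : Fin N → Euc N → ℝ) (x : Euc N) : ℝ≥0∞ := ENNReal.ofReal (gradNorm1 g x)

open Set in
lemma rep_radial {N : ℕ} (hN : 1 ≤ N) (u : Euc N → ℝ) (g : Fin N → Euc N → ℝ)
    (hu : RadSymm u) (hg : ∀ i, IsWeakPartialDeriv i u (g i)) :
    ∃ a : ℝ, ∀ᵐ x, ‖u x - a‖ₑ ≤
      ENNReal.ofReal ((N * volume.real (ball (0 : Euc N) 1))⁻¹) * (Tout (Dg g) x + Tin (Dg g) x) := by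
  have : Nonempty (Fin N) := ⟨⟨0, hN⟩⟩
  have hNpos : (0 : ℝ) < N := by exact_mod_cast hN
  have hfin : Module.finrank ℝ (Euc N) = N := by simp
  let i0 : Fin N := ⟨0, hN⟩
  have huL : LocallyIntegrable u volume := (hg i0).1
  set c : ℝ := N * volume.real (ball (0 : Euc N) 1) with hc
  have hvol : 0 < volume.real (ball (0 : Euc N) 1) :=
    ENNReal.toReal_pos (measure_ball_pos _ _ one_pos).ne' measure_ball_lt_top.ne
  have hcpos : 0 < c := by positivity
  let f : ℝ → ℝ := fun t => u (EuclideanSpace.single i0 t)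
  have huf : ∀ x, u x = f ‖x‖ := by
    intro x; apply hu; simp
  let G : Euc N → ℝ := fun x => ∑ i, g i x * (x i * (‖x‖ ^ N)⁻¹ * c⁻¹)
  have key := aux_prim (volume : Measure (Euc N)) (fun x => ‖x‖) measurable_norm G
    (I := Ioi 0) isOpen_Ioi ordConnected_Ioi (b := 1) (by simp) ?_ f ?_ ?_
  · obtain ⟨a, ha⟩ := key
    refine ⟨a, ?_⟩
    have h0 : ∀ᵐ x : Euc N, x ≠ 0 := by
      rw [ae_iff]; simp
    filter_upwards [aux_ae_norm hN ha, h0] with x hx hx0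
    have hx1 := hx (by simpa using hx0)
    rw [huf x]
    refine hx1.trans ?_
    have hsub : (fun x : Euc N => ‖x‖) ⁻¹' uIcc 1 ‖x‖ ⊆
        {y | 1 ≤ ‖y‖ ∧ ‖y‖ ≤ ‖x‖} ∪ {y | ‖x‖ ≤ ‖y‖ ∧ ‖y‖ ≤ 1} := by
      intro y hy
      rcases mem_uIcc.1 hy with h | h
      · exact Or.inl h
      · exact Or.inr h
    have hGle : ∀ y, ‖G y‖ₑ ≤ ENNReal.ofReal c⁻¹ * (Dg g y * ENNReal.ofReal (‖y‖ ^ (1 - (N : ℝ)))) := by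
      intro y
      rw [← ofReal_norm, Dg, ← ENNReal.ofReal_mul (by unfold gradNorm1; positivity),
        ← ENNReal.ofReal_mul (by positivity)]
      apply ENNReal.ofReal_le_ofReal
      by_cases hy : y = 0
      · subst hy
        simp [G]
        unfold gradNorm1
        positivity
      have hy' : 0 < ‖y‖ := by simpa using hy
      have e1 : G y = c⁻¹ * ((‖y‖ ^ N)⁻¹ * ∑ i, g i y * y i) := by
        simp only [G, Finset.mul_sum]
        refine Finset.sum_congr rfl fun i _ => by ring
      have e2 : |∑ i, g i y * y i| ≤ gradNorm1 g y * ‖y‖ := by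
        rw [EuclideanSpace.norm_eq, gradNorm1]
        have := Finset.sum_mul_sq_le_sq_mul_sq Finset.univ (fun i => g i y) (fun i => y i)
        rw [← Real.sqrt_mul (by positivity)]
        apply Real.abs_le_sqrt
        simpa using this
      rw [e1, Real.norm_eq_abs, abs_mul, abs_mul, abs_of_pos (by positivity : 0 < c⁻¹),
        abs_of_pos (by positivity : 0 < (‖y‖ ^ N)⁻¹)]
      rw [Real.rpow_sub hy', Real.rpow_one, Real.rpow_natCast]
      have : (‖y‖ ^ N)⁻¹ * |∑ i, g i y * y i| ≤ (‖y‖ ^ N)⁻¹ * (gradNorm1 g y * ‖y‖) := by gcongr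
      calc _ ≤ c⁻¹ * ((‖y‖ ^ N)⁻¹ * (gradNorm1 g y * ‖y‖)) := by gcongr
        _ = _ := by ring
    calc ∫⁻ y in (fun x : Euc N => ‖x‖) ⁻¹' uIcc 1 ‖x‖, ‖G y‖ₑ
        ≤ ∫⁻ y in {y | 1 ≤ ‖y‖ ∧ ‖y‖ ≤ ‖x‖} ∪ {y | ‖x‖ ≤ ‖y‖ ∧ ‖y‖ ≤ 1}, ‖G y‖ₑ :=
          lintegral_mono_set hsub
      _ ≤ ∫⁻ y in {y | 1 ≤ ‖y‖ ∧ ‖y‖ ≤ ‖x‖} ∪ {y | ‖x‖ ≤ ‖y‖ ∧ ‖y‖ ≤ 1},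
            ENNReal.ofReal c⁻¹ * (Dg g y * ENNReal.ofReal (‖y‖ ^ (1 - (N : ℝ)))) :=
          lintegral_mono hGle
      _ = ENNReal.ofReal c⁻¹ * ∫⁻ y in {y | 1 ≤ ‖y‖ ∧ ‖y‖ ≤ ‖x‖} ∪ {y | ‖x‖ ≤ ‖y‖ ∧ ‖y‖ ≤ 1},
            (Dg g y * ENNReal.ofReal (‖y‖ ^ (1 - (N : ℝ)))) :=
          lintegral_const_mul' _ _ ENNReal.ofReal_ne_top
      _ ≤ _ := by
          gcongr
          exact lintegral_union_le _ _ _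
  · intro m hm M hM
    have hm0 : 0 < m := hm
    have hK : IsCompact ((fun x : Euc N => ‖x‖) ⁻¹' Icc m M) := by
      refine (isCompact_closedBall (0 : Euc N) M).of_isClosed_subset
        (isClosed_Icc.preimage continuous_norm) ?_
      intro x hx
      simpa using hx.2
    refine integrable_finsetSum _ fun i _ => ?_
    refine IntegrableOn.mul_continuousOn ((hg i).2.1.integrableOn_isCompact hK) ?_ hK
    refine ContinuousOn.mul (ContinuousOn.mul ?_ ?_) continuousOn_const
    · exact (EuclideanSpace.proj (𝕜 := ℝ) i).continuous.continuousOn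
    · refine ContinuousOn.inv₀ (by fun_prop) ?_
      intro x hx
      have : 0 < ‖x‖ := hm0.trans_le hx.1
      positivity
  · rw [locallyIntegrableOn_iff isOpen_Ioi.isLocallyClosed]
    intro K hK hKc
    rcases K.eq_empty_or_nonempty with rfl | hne
    · simp
    obtain ⟨m, hm, M, hM, hKm⟩ := aux_exists_Icc hKc hne hK
    have hm0 : 0 < m := hm
    refine IntegrableOn.mono_set ?_ hKm
    have h1 : IntegrableOn (fun x : Euc N => f ‖x‖) (ball 0 (M + 1)) volume := by
      have := (huL.integrableOn_isCompact (isCompact_closedBall (0 : Euc N) (M + 1))).mono_set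
        ball_subset_closedBall
      exact this.congr (Eventually.of_forall huf)
    rw [integrableOn_fun_norm_addHaar, hfin] at h1
    have h2 : IntegrableOn (fun y : ℝ => y ^ (N - 1) • f y) (Icc m M) volume :=
      h1.mono_set fun t ht => ⟨hm0.trans_le ht.1, by linarith [ht.2]⟩
    have h3 := h2.mul_continuousOn (g' := fun t : ℝ => (t ^ (N - 1))⁻¹) (ContinuousOn.inv₀ (by fun_prop) (by
      intro t ht
      have : 0 < t := hm0.trans_le ht.1
      positivity)) isCompact_Icc
    refine h3.congr_fun ?_ measurableSet_Icc
    intro t ht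
    have : 0 < t := hm0.trans_le ht.1
    simp only [smul_eq_mul]
    field_simp
  · intro ψ hψ hψc hψs
    have hI1 : ∀ i, Integrable (fun x => u x * fderiv ℝ (tf ψ i) x (EuclideanSpace.single i 1)) := by
      intro i
      have hcd : ContDiff ℝ (⊤ : ℕ∞) (tf ψ i : Euc N → ℝ) := tf_contDiff hψ hψs i
      refine huL.integrable_smul_right_of_hasCompactSupport ?_ ?_
      · exact (hcd.continuous_fderiv (by simp)).clm_apply continuous_const
      · exact (tf_compact hψc i).fderiv_apply ℝ _
    have hI2 : ∀ i, Integrable (fun x => g i x * tf ψ i x) := fun i =>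
      (hg i).2.1.integrable_smul_right_of_hasCompactSupport (tf_contDiff hψ hψs i).continuous
        (tf_compact hψc i)
    have h1 : ∑ i, ∫ x, u x * fderiv ℝ (tf ψ i) x (EuclideanSpace.single i 1) =
        ∑ i, - ∫ x, g i x * tf ψ i x := by
      refine Finset.sum_congr rfl fun i _ => ?_
      have := (hg i).2.2 (tf ψ i) (tf_contDiff hψ hψs i) (tf_compact hψc i)
      simpa [pderivList] using this
    rw [← integral_finsetSum _ (fun i _ => hI1 i), Finset.sum_neg_distrib,
      ← integral_finsetSum _ (fun i _ => hI2 i)] at h1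
    simp_rw [← Finset.mul_sum, tf_div hψ hψs hN, huf] at h1
    rw [integral_fun_norm_addHaar volume (fun t => f t * (deriv ψ t * (t ^ (N - 1))⁻¹)), hfin] at h1
    have h2 : ∫ y in Ioi (0 : ℝ), y ^ (N - 1) • (f y * (deriv ψ y * (y ^ (N - 1))⁻¹)) =
        ∫ t, f t * deriv ψ t := by
      rw [← setIntegral_eq_integral_of_forall_compl_eq_zero (s := Ioi (0 : ℝ))
        (f := fun t => f t * deriv ψ t)]
      · refine setIntegral_congr_fun measurableSet_Ioi ?_
        intro t ht
        have : 0 < t := ht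
        simp only [smul_eq_mul]
        field_simp
      · intro t ht
        have : t ∉ tsupport (deriv ψ) :=
          fun h => ht (hψs (tsupport_deriv_subset (𝕜 := ℝ) h))
        rw [image_eq_zero_of_notMem_tsupport this, mul_zero]
    rw [h2] at h1
    have h3 : ∫ x, G x * ψ ‖x‖ = c⁻¹ * ∫ x, ∑ i, g i x * tf ψ i x := by
      rw [← integral_const_mul]
      congr 1; ext x
      simp only [G, tf, Finset.sum_mul, Finset.mul_sum]
      refine Finset.sum_congr rfl fun i _ => by ring
    rw [h3]
    have h4 : c * ∫ t, f t * deriv ψ t = - ∫ x, ∑ i, g i x * tf ψ i x := by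
      rw [← h1, hc]; simp; ring
    have : ∫ t, f t * deriv ψ t = c⁻¹ * (c * ∫ t, f t * deriv ψ t) := by
      field_simp
    rw [this, h4]; ring

lemma aux_e1 : ∃ e : ℝ ≃ₜ Euc 1, MeasurePreserving e volume volume ∧
    MeasurePreserving e.symm volume volume ∧ (∀ t : ℝ, (e t) 0 = t) ∧
    (∀ x : Euc 1, e.symm x = x 0) := by
  let e := (OrthonormalBasis.singleton (Fin 1) ℝ).repr
  have he0 : ∀ t : ℝ, (e t) 0 = t := by
    intro t
    simp [e, OrthonormalBasis.repr_apply_apply]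
  refine ⟨e.toHomeomorph, e.measurePreserving, e.symm.measurePreserving, he0, ?_⟩
  intro x
  rw [Homeomorph.symm_apply_eq]
  ext i
  have : i = 0 := Subsingleton.elim _ _
  subst this
  exact (he0 _).symm

open Set in
lemma rep_one (u : Euc 1 → ℝ) (g : Fin 1 → Euc 1 → ℝ)
    (hg : ∀ i, IsWeakPartialDeriv i u (g i)) :
    ∃ a : ℝ, ∀ᵐ x, ‖u x - a‖ₑ ≤ Tout (Dg g) x + Bin (Dg g) := by
  obtain ⟨e, hmp, hmps, he0, hes⟩ := aux_e1
  have hnorm : ∀ x : Euc 1, |x 0| = ‖x‖ := by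
    intro x; simp [EuclideanSpace.norm_eq, Real.sqrt_sq_eq_abs]
  have hemb : MeasurableEmbedding e := e.measurableEmbedding
  have huL : LocallyIntegrable u volume := (hg 0).1
  have key := aux_prim (volume : Measure (Euc 1)) (fun x => x 0)
    (by fun_prop) (g 0)
    (I := univ) isOpen_univ ordConnected_univ (b := 0) (by simp) ?_ (fun t => u (e t)) ?_ ?_
  · obtain ⟨a, ha⟩ := key
    refine ⟨a, ?_⟩
    have h1 := hmps.quasiMeasurePreserving.ae ha
    filter_upwards [h1] with x hx
    have hx1 := hx (mem_univ _)
    rw [Homeomorph.apply_symm_apply, hes] at hx1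
    refine hx1.trans ?_
    have hsub : (fun x : Euc 1 => x 0) ⁻¹' uIcc 0 (x 0) ⊆
        {y | 1 ≤ ‖y‖ ∧ ‖y‖ ≤ ‖x‖} ∪ {y | ‖y‖ ≤ 1} := by
      intro y hy
      have h2 : ‖y‖ ≤ ‖x‖ := by
        rw [← hnorm, ← hnorm]
        have := abs_sub_left_of_mem_uIcc hy
        simpa using this
      rcases le_total 1 ‖y‖ with h | h
      · exact Or.inl ⟨h, h2⟩
      · exact Or.inr h
    have hD : ∀ y, ‖g 0 y‖ₑ = Dg g y := by
      intro y
      simp [Dg, gradNorm1, Real.sqrt_sq_eq_abs, ← ofReal_norm]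
    calc ∫⁻ y in (fun x : Euc 1 => x 0) ⁻¹' uIcc 0 (x 0), ‖g 0 y‖ₑ
        ≤ ∫⁻ y in {y | 1 ≤ ‖y‖ ∧ ‖y‖ ≤ ‖x‖} ∪ {y | ‖y‖ ≤ 1}, ‖g 0 y‖ₑ := lintegral_mono_set hsub
      _ = ∫⁻ y in {y | 1 ≤ ‖y‖ ∧ ‖y‖ ≤ ‖x‖} ∪ {y | ‖y‖ ≤ 1}, Dg g y := by simp_rw [hD]
      _ ≤ _ := lintegral_union_le _ _ _
      _ = _ := by simp [Tout, Bin]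
  · intro m _ M _
    have hK : IsCompact ((fun x : Euc 1 => x 0) ⁻¹' Icc m M) := by
      have : (fun x : Euc 1 => x 0) ⁻¹' Icc m M = e '' Icc m M := by
        ext x
        rw [Homeomorph.image_eq_preimage_symm]
        simp [hes]
      rw [this]
      exact isCompact_Icc.image e.continuous
    exact (hg 0).2.1.integrableOn_isCompact hK
  · rw [locallyIntegrableOn_univ, locallyIntegrable_iff]
    intro K hK
    have := huL.integrableOn_isCompact (hK.image e.continuous)
    exact (hmp.integrableOn_image hemb).1 this
  · intro ψ hψ hψc _
    have hlin : ∀ x : Euc 1, x 0 = EuclideanSpace.proj (𝕜 := ℝ) (0 : Fin 1) x := fun _ => rfl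
    have h := (hg 0).2.2 (fun x => ψ (x 0))
      (hψ.comp (EuclideanSpace.proj (𝕜 := ℝ) (0 : Fin 1)).contDiff) ?_
    · have hd : ∀ x : Euc 1, fderiv ℝ (fun x : Euc 1 => ψ (x 0)) x (EuclideanSpace.single 0 1) =
          deriv ψ (x 0) := by
        intro x
        have hψ1 : HasDerivAt ψ (deriv ψ (x 0)) (x 0) :=
          (hψ.differentiable (by simp) _).hasDerivAt
        have := hψ1.comp_hasFDerivAt x (EuclideanSpace.proj (𝕜 := ℝ) (0 : Fin 1)).hasFDerivAt
        have h2 := this.fderiv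
        have e1 : (ψ ∘ fun x : Euc 1 => (EuclideanSpace.proj (𝕜 := ℝ) (0 : Fin 1)) x) =
          fun x : Euc 1 => ψ (x 0) := rfl
        change fderiv ℝ (fun x : Euc 1 => ψ (x 0)) x = _ at h2
        rw [h2]; simp
      simp only [pderivList, hd, List.length_singleton, pow_one, neg_mul, one_mul] at h
      rw [← h, ← hmp.integral_comp hemb]
      simp [he0]
    · have : HasCompactSupport (ψ ∘ e.symm) :=
        hψc.comp_homeomorph _
      convert this using 1
      ext x; simp [hes]

lemma hk_meas_left {N : ℕ} (β : ℝ) (x : Euc N) : Measurable (fun y => hk β x y) :=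
  (hk_meas β).comp (g := fun z : Euc N × Euc N => hk β z.1 z.2) (f := fun y => (x, y)) (by fun_prop)

lemma hk_meas_right {N : ℕ} (β : ℝ) (y : Euc N) : Measurable (fun x => hk β x y) :=
  (hk_meas β).comp (g := fun z : Euc N × Euc N => hk β z.1 z.2) (f := fun x => (x, y)) (by fun_prop)

lemma rep_all {N : ℕ} (hN : 1 ≤ N) : ∃ c0 : ℝ≥0∞, c0 ≠ ∞ ∧
    ∀ (u : Euc N → ℝ) (g : Fin N → Euc N → ℝ), (N = 1 ∨ RadSymm u) →
      (∀ i, IsWeakPartialDeriv i u (g i)) →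
      ∃ D : Euc N → ℝ≥0∞, Measurable D ∧ D =ᵐ[volume] Dg g ∧
        ∃ a : ℝ, ∀ᵐ x, ‖u x - a‖ₑ ≤ c0 * (Tout D x + Tin D x + Bin D) := by
  refine ⟨ENNReal.ofReal ((N * volume.real (ball (0 : Euc N) 1))⁻¹) + 1,
    ENNReal.add_ne_top.2 ⟨ENNReal.ofReal_ne_top, ENNReal.one_ne_top⟩, ?_⟩
  intro u g hor hg
  have hm : AEMeasurable (Dg g) volume := by
    unfold Dg gradNorm1
    have : ∀ i, AEMeasurable (g i) volume := fun i =>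
      (hg i).2.1.aestronglyMeasurable.aemeasurable
    have h2 : AEMeasurable (fun x => ∑ i, g i x ^ 2) volume :=
      Finset.aemeasurable_fun_sum _ fun i _ => (this i).pow_const 2
    exact (Real.continuous_sqrt.measurable.comp_aemeasurable h2).ennreal_ofReal
  have hDe : hm.mk _ =ᵐ[volume] Dg g := hm.ae_eq_mk.symm
  refine ⟨hm.mk _, hm.measurable_mk, hDe, ?_⟩
  have e1 : ∀ x, Tout (hm.mk _) x = Tout (Dg g) x := fun x =>
    lintegral_congr_ae (ae_restrict_of_ae (hDe.mono fun y hy => by simp only [hy]))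
  have e2 : ∀ x, Tin (hm.mk _) x = Tin (Dg g) x := fun x =>
    lintegral_congr_ae (ae_restrict_of_ae (hDe.mono fun y hy => by simp only [hy]))
  have e3 : Bin (hm.mk _) = Bin (Dg g) :=
    lintegral_congr_ae (ae_restrict_of_ae (hDe.mono fun y hy => by simp only [hy]))
  simp_rw [e1, e2, e3]
  by_cases h1 : N = 1
  · subst h1
    obtain ⟨a, ha⟩ := rep_one u g hg
    refine ⟨a, ha.mono fun x hx => hx.trans ?_⟩
    calc Tout (Dg g) x + Bin (Dg g) ≤ Tout (Dg g) x + Tin (Dg g) x + Bin (Dg g) := by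
          gcongr; exact le_self_add
      _ = 1 * (Tout (Dg g) x + Tin (Dg g) x + Bin (Dg g)) := (one_mul _).symm
      _ ≤ _ := by gcongr; exact le_add_self
  · obtain ⟨a, ha⟩ := rep_radial hN u g (hor.resolve_left h1) hg
    refine ⟨a, ha.mono fun x hx => hx.trans ?_⟩
    exact mul_le_mul' le_self_add le_self_add

/-- the weighted norm of the gradient -/
def Mp (N : ℕ) (s p : ℝ) (D : Euc N → ℝ≥0∞) : ℝ≥0∞ :=
  (∫⁻ y, (ENNReal.ofReal ((1 + ‖y‖) ^ (-s - (N : ℝ) / p)) * D y) ^ p) ^ (1 / p)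

lemma Mp_bound {N : ℕ} (s p : ℝ) (hp : 1 ≤ p) (D F : Euc N → ℝ≥0∞) (hF : Measurable F)
    (C : ℝ≥0∞) (hC : C ≠ ∞)
    (h : ∀ y, ENNReal.ofReal (‖y‖ ^ (-((N : ℝ) / p))) * F y ≤
      C * (ENNReal.ofReal ((1 + ‖y‖) ^ (-s - (N : ℝ) / p)) * D y)) :
    (∫⁻ y, F y ^ p ∂(muN N)) ^ (1 / p) ≤ C * Mp N s p D := by
  have hp0 : 0 < p := by linarith
  rw [lintegral_muN _ (hF.pow_const p)]
  have e : ∀ y : Euc N, ENNReal.ofReal (‖y‖ ^ (-(N : ℝ))) * F y ^ p =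
      (ENNReal.ofReal (‖y‖ ^ (-((N : ℝ) / p))) * F y) ^ p := by
    intro y
    rw [ENNReal.mul_rpow_of_nonneg _ _ hp0.le, ENNReal.ofReal_rpow_of_nonneg (by positivity) hp0.le,
      ← Real.rpow_mul (by positivity)]
    congr 3
    field_simp
  simp_rw [e]
  have h2 : ∫⁻ y, (ENNReal.ofReal (‖y‖ ^ (-((N : ℝ) / p))) * F y) ^ p ≤
      C ^ p * ∫⁻ y, (ENNReal.ofReal ((1 + ‖y‖) ^ (-s - (N : ℝ) / p)) * D y) ^ p := by
    rw [← lintegral_const_mul' _ _ (by simp [hC, hp0.le])]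
    refine lintegral_mono fun y => ?_
    rw [← ENNReal.mul_rpow_of_nonneg _ _ hp0.le]
    exact ENNReal.rpow_le_rpow (h y) hp0.le
  refine (ENNReal.rpow_le_rpow h2 (by positivity)).trans_eq ?_
  rw [ENNReal.mul_rpow_of_nonneg _ _ (by positivity), ← ENNReal.rpow_mul,
    mul_one_div_cancel hp0.ne', ENNReal.rpow_one, Mp]

lemma aux_w_out {t : ℝ} (ht : 1 ≤ t) (e : ℝ) : t ^ e ≤ 2 ^ |e| * (1 + t) ^ e := by
  have ht0 : 0 < t := by linarith
  rcases le_total 0 e with he | he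
  · have h1 : t ^ e ≤ (1 + t) ^ e := Real.rpow_le_rpow ht0.le (by linarith) he
    have h2 : (1 : ℝ) ≤ 2 ^ |e| := Real.one_le_rpow (by norm_num) (abs_nonneg _)
    nlinarith [Real.rpow_nonneg (by linarith : 0 ≤ 1 + t) e]
  · have h1 : (2 * t) ^ e ≤ (1 + t) ^ e :=
      Real.rpow_le_rpow_of_nonpos (by linarith) (by linarith) he
    rw [Real.mul_rpow (by norm_num) ht0.le] at h1
    rw [abs_of_nonpos he]
    calc t ^ e = 2 ^ (-e) * (2 ^ e * t ^ e) := by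
          rw [← mul_assoc, ← Real.rpow_add (by norm_num)]; simp
      _ ≤ _ := by gcongr

lemma aux_w_in {t : ℝ} (ht0 : 0 ≤ t) (ht : t ≤ 1) (e : ℝ) : 1 ≤ 2 ^ |e| * (1 + t) ^ e := by
  rcases le_total 0 e with he | he
  · have h1 : 1 ≤ (1 + t) ^ e := Real.one_le_rpow (by linarith) he
    have h2 : (1 : ℝ) ≤ 2 ^ |e| := Real.one_le_rpow (by norm_num) (abs_nonneg _)
    nlinarith
  · have h1 : (2 : ℝ) ^ e ≤ (1 + t) ^ e :=
      Real.rpow_le_rpow_of_nonpos (by linarith) (by linarith) he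
    rw [abs_of_nonpos he]
    calc (1 : ℝ) = 2 ^ (-e) * 2 ^ e := by
          rw [← Real.rpow_add (by norm_num)]; simp
      _ ≤ _ := by gcongr

/-- the comparison constant -/
def cw (N : ℕ) (s p : ℝ) : ℝ≥0∞ := ENNReal.ofReal (2 ^ |-s - (N : ℝ) / p|)

lemma cw_ne (N : ℕ) (s p : ℝ) : cw N s p ≠ ∞ := ENNReal.ofReal_ne_top

/-- outer density -/
def Fout {N : ℕ} (s : ℝ) (D : Euc N → ℝ≥0∞) (y : Euc N) : ℝ≥0∞ :=
  if 1 ≤ ‖y‖ then D y * ENNReal.ofReal (‖y‖ ^ (-s)) else 0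

/-- inner density -/
def Finn {N : ℕ} (e : ℝ) (D : Euc N → ℝ≥0∞) (y : Euc N) : ℝ≥0∞ :=
  if ‖y‖ ≤ 1 then D y * ENNReal.ofReal (‖y‖ ^ e) else 0

lemma Fout_meas {N : ℕ} (s : ℝ) {D : Euc N → ℝ≥0∞} (hD : Measurable D) : Measurable (Fout s D) := by
  unfold Fout
  exact Measurable.ite (measurableSet_le measurable_const measurable_norm) (by fun_prop)
    measurable_const

lemma Finn_meas {N : ℕ} (e : ℝ) {D : Euc N → ℝ≥0∞} (hD : Measurable D) : Measurable (Finn e D) := by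
  unfold Finn
  exact Measurable.ite (measurableSet_le measurable_norm measurable_const) (by fun_prop)
    measurable_const

lemma Fout_bound {N : ℕ} (s p : ℝ) (hp : 1 ≤ p) {D : Euc N → ℝ≥0∞} (hD : Measurable D) :
    (∫⁻ y, Fout s D y ^ p ∂(muN N)) ^ (1 / p) ≤ cw N s p * Mp N s p D := by
  refine Mp_bound s p hp D _ (Fout_meas s hD) _ (cw_ne _ _ _) fun y => ?_
  unfold Fout
  split_ifs with hy
  · have hy0 : 0 < ‖y‖ := by linarith
    have h := aux_w_out hy (-s - (N : ℝ) / p)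
    calc _ = ENNReal.ofReal (‖y‖ ^ (-s - (N : ℝ) / p)) * D y := by
          rw [mul_comm (D y), ← mul_assoc, ← ENNReal.ofReal_mul (by positivity),
            ← Real.rpow_add hy0]
          congr 3; ring
      _ ≤ ENNReal.ofReal (2 ^ |-s - (N : ℝ) / p| * (1 + ‖y‖) ^ (-s - (N : ℝ) / p)) * D y := by
          gcongr
      _ = _ := by
          rw [ENNReal.ofReal_mul (by positivity), mul_assoc]; rfl
  · simp

lemma Finn_bound {N : ℕ} (hN : 1 ≤ N) (s p e : ℝ) (hp : 1 ≤ p) (he : (N : ℝ) / p ≤ e)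
    {D : Euc N → ℝ≥0∞} (hD : Measurable D) :
    (∫⁻ y, Finn e D y ^ p ∂(muN N)) ^ (1 / p) ≤ cw N s p * Mp N s p D := by
  refine Mp_bound s p hp D _ (Finn_meas e hD) _ (cw_ne _ _ _) fun y => ?_
  have hNpos : (0 : ℝ) < N := by exact_mod_cast hN
  have hp0 : 0 < p := by linarith
  unfold Finn
  split_ifs with hy
  · have h := aux_w_in (norm_nonneg y) hy (-s - (N : ℝ) / p)
    have h1 : ‖y‖ ^ (-((N : ℝ) / p)) * ‖y‖ ^ e ≤ 1 := by
      rcases (norm_nonneg y).eq_or_lt with h0 | h0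
      · rw [← h0, Real.zero_rpow (by
          have : 0 < (N : ℝ) / p := by positivity
          linarith)]
        simp
      · rw [← Real.rpow_add h0]
        exact Real.rpow_le_one h0.le hy (by linarith)
    calc _ = ENNReal.ofReal (‖y‖ ^ (-((N : ℝ) / p)) * ‖y‖ ^ e) * D y := by
          rw [mul_comm (D y), ← mul_assoc, ← ENNReal.ofReal_mul (by positivity)]
      _ ≤ ENNReal.ofReal (2 ^ |-s - (N : ℝ) / p| * (1 + ‖y‖) ^ (-s - (N : ℝ) / p)) * D y := by
          gcongr ENNReal.ofReal ?_ * D y; exact h1.trans h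
      _ = _ := by
          rw [ENNReal.ofReal_mul (by positivity), mul_assoc]; rfl
  · simp

open Set in
lemma ball_int {N : ℕ} (hN : 1 ≤ N) (s p e : ℝ) (hp : 1 ≤ p)
    (he : e < N - (N : ℝ) / p ∨ (p = 1 ∧ e = 0)) : ∃ C : ℝ≥0∞, C ≠ ∞ ∧
    ∀ D : Euc N → ℝ≥0∞, Measurable D →
      ∫⁻ y in {y : Euc N | ‖y‖ ≤ 1}, D y * ENNReal.ofReal (‖y‖ ^ (-e)) ≤ C * Mp N s p D := by
  have hset : MeasurableSet {y : Euc N | ‖y‖ ≤ 1} := measurableSet_le measurable_norm measurable_const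
  have : Nonempty (Fin N) := ⟨⟨0, hN⟩⟩
  rcases he with he | ⟨rfl, rfl⟩
  · set γ : ℝ := N - (N : ℝ) / p - e with hγ
    have hγ0 : 0 < γ := by linarith
    refine ⟨hA N γ ^ ((p - 1) / p) * cw N s p, ?_, ?_⟩
    · exact ENNReal.mul_ne_top (ENNReal.rpow_ne_top_of_nonneg
        (div_nonneg (by linarith) (by linarith)) (hA_ne_top _ _)) (cw_ne _ _ _)
    · intro D hD
      let x0 : Euc N := EuclideanSpace.single ⟨0, hN⟩ 1
      have hx0 : ‖x0‖ = 1 := by simp [x0]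
      have h := schur2 (muN N) (hk γ) (hk_meas γ) (hk_le_one hγ0) _ (hk_int_right hN hγ0)
        (Finn ((N : ℝ) / p) D) (Finn_meas _ hD) p hp x0
      have hb := Finn_bound hN s p ((N : ℝ) / p) hp le_rfl hD
      rw [mul_assoc]
      refine le_trans ?_ (h.trans (by gcongr))
      rw [lintegral_muN (fun y => hk γ x0 y * Finn ((N : ℝ) / p) D y)
          ((hk_meas_left γ x0).mul (Finn_meas _ hD)),
        ← lintegral_indicator hset]
      refine lintegral_mono_ae ?_
      have h0 : ∀ᵐ x : Euc N, x ≠ 0 := by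
        rw [ae_iff]; simp
      filter_upwards [h0] with y hy0
      by_cases hy : ‖y‖ ≤ 1
      · have hy' : 0 < ‖y‖ := by simpa using hy0
        rw [indicator_of_mem (by exact hy), hk, Finn, if_pos hy, if_pos ⟨hy', by rw [hx0]; exact hy⟩,
          hx0, div_one, mul_comm (D y), mul_comm (D y), ← mul_assoc, ← mul_assoc,
          ← ENNReal.ofReal_mul (by positivity), ← ENNReal.ofReal_mul (by positivity),
          ← Real.rpow_add hy', ← Real.rpow_add hy']
        apply le_of_eq
        congr 3
        rw [hγ]; ring
      · rw [indicator_of_notMem (by exact hy)]; exact zero_le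
  · refine ⟨cw N s 1, cw_ne _ _ _, fun D hD => ?_⟩
    have hb := Finn_bound hN s 1 (N : ℝ) le_rfl (by simp) hD
    refine le_trans ?_ hb
    simp only [ENNReal.rpow_one, ne_eq, one_ne_zero, not_false_eq_true, div_self]
    rw [lintegral_muN _ (Finn_meas _ hD), ← lintegral_indicator hset]
    refine lintegral_mono_ae ?_
    have h0 : ∀ᵐ x : Euc N, x ≠ 0 := by
      rw [ae_iff]; simp
    filter_upwards [h0] with y hy0
    by_cases hy : ‖y‖ ≤ 1
    · have hy' : 0 < ‖y‖ := by simpa using hy0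
      rw [indicator_of_mem (by exact hy), Finn, if_pos hy, mul_comm (D y), mul_comm (D y), ← mul_assoc,
          ← ENNReal.ofReal_mul (by positivity), ← Real.rpow_add hy']
      simp
    · rw [indicator_of_notMem (by exact hy)]; exact zero_le

/-- the outer Hardy transform -/
def wout {N : ℕ} (s : ℝ) (D : Euc N → ℝ≥0∞) (x : Euc N) : ℝ≥0∞ :=
  ∫⁻ y, hk (s + 1) x y * Fout s D y ∂(muN N)

/-- the inner Hardy transform -/
def win {N : ℕ} (α : ℝ) (D : Euc N → ℝ≥0∞) (x : Euc N) : ℝ≥0∞ :=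
  ∫⁻ y, hk α y x * Finn (1 + α) D y ∂(muN N)

lemma wout_meas {N : ℕ} (s : ℝ) {D : Euc N → ℝ≥0∞} (hD : Measurable D) :
    Measurable (wout s D) := by
  unfold wout
  refine Measurable.lintegral_prod_right' (f := fun z : Euc N × Euc N =>
    hk (s + 1) z.1 z.2 * Fout s D z.2) ?_
  exact (hk_meas _).mul ((Fout_meas s hD).comp measurable_snd)

lemma hk_meas_swap {N : ℕ} (β : ℝ) : Measurable (fun z : Euc N × Euc N => hk β z.2 z.1) := by
  have h := (hk_meas (N := N) β).comp measurable_swap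
  exact h

lemma win_meas {N : ℕ} (α : ℝ) {D : Euc N → ℝ≥0∞} (hD : Measurable D) :
    Measurable (win α D) := by
  unfold win
  refine Measurable.lintegral_prod_right' (f := fun z : Euc N × Euc N =>
    hk α z.2 z.1 * Finn (1 + α) D z.2) ?_
  exact (hk_meas_swap _).mul ((Finn_meas _ hD).comp measurable_snd)

open Set in
lemma wout_pt {N : ℕ} (s : ℝ) {D : Euc N → ℝ≥0∞} (hD : Measurable D) {x : Euc N} (hx : 0 < ‖x‖) :
    ENNReal.ofReal (‖x‖ ^ (-(s + 1))) * Tout D x ≤ wout s D x := by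
  have hset : MeasurableSet {y : Euc N | 1 ≤ ‖y‖ ∧ ‖y‖ ≤ ‖x‖} :=
    (measurableSet_le measurable_const measurable_norm).inter
      (measurableSet_le measurable_norm measurable_const)
  unfold Tout wout
  rw [← lintegral_indicator hset, ← lintegral_const_mul' _ _ ENNReal.ofReal_ne_top,
    lintegral_muN (fun y => hk (s + 1) x y * Fout s D y) ((hk_meas_left _ x).mul (Fout_meas s hD))]
  refine lintegral_mono fun y => ?_
  by_cases hy : 1 ≤ ‖y‖ ∧ ‖y‖ ≤ ‖x‖
  · have hy0 : 0 < ‖y‖ := by linarith [hy.1]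
    rw [indicator_of_mem (by exact hy), hk, Fout, if_pos hy.1, if_pos ⟨hy0, hy.2⟩,
      mul_comm (D y), mul_comm (D y)]
    simp only [← mul_assoc]
    rw [← ENNReal.ofReal_mul (by positivity), ← ENNReal.ofReal_mul (by positivity),
      ← ENNReal.ofReal_mul (by positivity)]
    apply le_of_eq
    congr 2
    rw [Real.div_rpow hy0.le hx.le, Real.rpow_neg hx.le, div_eq_mul_inv]
    have : ‖y‖ ^ (1 - (N : ℝ)) = ‖y‖ ^ (-(N : ℝ)) * ‖y‖ ^ (s + 1) * ‖y‖ ^ (-s) := by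
      rw [← Real.rpow_add hy0, ← Real.rpow_add hy0]; congr 1; ring
    rw [this]; ring
  · rw [indicator_of_notMem (by exact hy)]; simp

open Set in
lemma win_pt {N : ℕ} (α : ℝ) {D : Euc N → ℝ≥0∞} (hD : Measurable D) {x : Euc N} (hx : 0 < ‖x‖) :
    ENNReal.ofReal (‖x‖ ^ α) * Tin D x ≤ win α D x := by
  have hset : MeasurableSet {y : Euc N | ‖x‖ ≤ ‖y‖ ∧ ‖y‖ ≤ 1} :=
    (measurableSet_le measurable_const measurable_norm).inter
      (measurableSet_le measurable_norm measurable_const)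
  unfold Tin win
  rw [← lintegral_indicator hset, ← lintegral_const_mul' _ _ ENNReal.ofReal_ne_top,
    lintegral_muN (fun y => hk α y x * Finn (1 + α) D y) ((hk_meas_right _ x).mul (Finn_meas _ hD))]
  refine lintegral_mono fun y => ?_
  by_cases hy : ‖x‖ ≤ ‖y‖ ∧ ‖y‖ ≤ 1
  · have hy0 : 0 < ‖y‖ := by linarith [hy.1]
    rw [indicator_of_mem (by exact hy), hk, Finn, if_pos hy.2, if_pos ⟨hx, hy.1⟩,
      mul_comm (D y), mul_comm (D y)]
    simp only [← mul_assoc]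
    rw [← ENNReal.ofReal_mul (by positivity), ← ENNReal.ofReal_mul (by positivity),
      ← ENNReal.ofReal_mul (by positivity)]
    apply le_of_eq
    congr 2
    rw [Real.div_rpow hx.le hy0.le, div_eq_mul_inv, ← Real.rpow_neg hy0.le]
    have : ‖y‖ ^ (1 - (N : ℝ)) = ‖y‖ ^ (-(N : ℝ)) * ‖y‖ ^ (-α) * ‖y‖ ^ (1 + α) := by
      rw [← Real.rpow_add hy0, ← Real.rpow_add hy0]; congr 1; ring
    rw [this]; ring
  · rw [indicator_of_notMem (by exact hy)]; simp

lemma tr_eLp {N : ℕ} (q : ℝ≥0∞) (hq : 1 ≤ q) (w : Euc N → ℝ≥0∞) (hw : Measurable w) (B : ℝ≥0∞)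
    (h1 : q ≠ ∞ → (∫⁻ x, w x ^ q.toReal ∂(muN N)) ^ (1 / q.toReal) ≤ B)
    (h2 : q = ∞ → ∀ x, w x ≤ B) :
    eLpNorm (fun x : Euc N => ENNReal.ofReal (‖x‖ ^ (-((N : ℝ) / q.toReal))) * w x) q volume ≤ B := by
  have hq0 : q ≠ 0 := (lt_of_lt_of_le one_pos hq).ne'
  by_cases hqt : q = ∞
  · subst hqt
    rw [eLpNorm_exponent_top, eLpNormEssSup]
    refine essSup_le_of_ae_le _ (Eventually.of_forall fun x => ?_)
    simpa using h2 rfl x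
  · have hr : 0 < q.toReal := ENNReal.toReal_pos hq0 hqt
    rw [eLpNorm_eq_lintegral_rpow_enorm_toReal hq0 hqt]
    refine le_trans (le_of_eq ?_) (h1 hqt)
    rw [lintegral_muN _ (hw.pow_const _)]
    congr 1
    refine lintegral_congr fun x => ?_
    rw [enorm_eq_self, ENNReal.mul_rpow_of_nonneg _ _ hr.le,
      ENNReal.ofReal_rpow_of_nonneg (by positivity) hr.le, ← Real.rpow_mul (by positivity)]
    congr 3
    field_simp

/-- Weighted estimate for an operator. -/
def Est (N : ℕ) (s p : ℝ) (q : ℝ≥0∞) (T : (Euc N → ℝ≥0∞) → Euc N → ℝ≥0∞) : Prop :=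
  ∃ C : ℝ≥0∞, C ≠ ∞ ∧ ∀ D : Euc N → ℝ≥0∞, Measurable D → ∃ h : Euc N → ℝ≥0∞, Measurable h ∧
    (∀ᵐ x, ENNReal.ofReal (wt N (s + 1) q x) * T D x ≤ h x) ∧
    eLpNorm h q volume ≤ C * Mp N s p D

lemma Est.add {N : ℕ} {s p : ℝ} {q : ℝ≥0∞} (hq : 1 ≤ q) {T S : (Euc N → ℝ≥0∞) → Euc N → ℝ≥0∞}
    (hT : Est N s p q T) (hS : Est N s p q S) : Est N s p q (fun D x => T D x + S D x) := by
  obtain ⟨C, hC, h⟩ := hT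
  obtain ⟨C', hC', h'⟩ := hS
  refine ⟨C + C', ENNReal.add_ne_top.2 ⟨hC, hC'⟩, fun D hD => ?_⟩
  obtain ⟨f, hf, hf1, hf2⟩ := h D hD
  obtain ⟨f', hf', hf1', hf2'⟩ := h' D hD
  refine ⟨f + f', hf.add hf', ?_, ?_⟩
  · filter_upwards [hf1, hf1'] with x h1 h2
    rw [mul_add]
    exact add_le_add h1 h2
  · rw [add_mul]
    exact (eLpNorm_add_le hf.aestronglyMeasurable hf'.aestronglyMeasurable hq).trans
      (add_le_add hf2 hf2')

lemma aux_ae_pos {N : ℕ} (hN : 1 ≤ N) : ∀ᵐ x : Euc N, 0 < ‖x‖ := by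
  have : Nonempty (Fin N) := ⟨⟨0, hN⟩⟩
  have h0 : ∀ᵐ x : Euc N, x ≠ 0 := by
    rw [ae_iff]; simp
  exact h0.mono fun x hx => norm_pos_iff.2 hx

lemma est_out {N : ℕ} (hN : 1 ≤ N) {s p : ℝ} (hs : -1 < s) (hp : 1 ≤ p) {q : ℝ≥0∞}
    (hq : ENNReal.ofReal p ≤ q) : Est N s p q Tout := by
  have hβ : 0 < s + 1 := by linarith
  have hp0 : 0 < p := by linarith
  have hq1 : 1 ≤ q := le_trans (by simpa using hp) hq
  have hq0 : q ≠ 0 := (lt_of_lt_of_le one_pos hq1).ne'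
  have hex : ∃ C : ℝ≥0∞, C ≠ ∞ ∧ ∀ D : Euc N → ℝ≥0∞, Measurable D →
      (q ≠ ∞ → (∫⁻ x, wout s D x ^ q.toReal ∂(muN N)) ^ (1 / q.toReal) ≤ C * Mp N s p D) ∧
      (q = ∞ → ∀ x, wout s D x ≤ C * Mp N s p D) := by
    by_cases hqt : q = ∞
    · refine ⟨hA N (s + 1) ^ ((p - 1) / p) * cw N s p, ?_, fun D hD => ⟨fun h => absurd hqt h, ?_⟩⟩
      · exact ENNReal.mul_ne_top (ENNReal.rpow_ne_top_of_nonneg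
          (div_nonneg (by linarith) (by linarith)) (hA_ne_top _ _)) (cw_ne _ _ _)
      · intro _ x
        have h := schur2 (muN N) (hk (s + 1)) (hk_meas _) (hk_le_one hβ) _ (hk_int_right hN hβ)
          (Fout s D) (Fout_meas s hD) p hp x
        rw [mul_assoc]
        refine h.trans ?_
        gcongr
        exact Fout_bound s p hp hD
    · have hpq : p ≤ q.toReal := (ENNReal.ofReal_le_iff_le_toReal hqt).1 hq
      refine ⟨hA N (s + 1) ^ (((p - 1) / p * (q.toReal - p) + p) / q.toReal) * cw N s p, ?_,
        fun D hD => ⟨fun _ => ?_, fun h => absurd h hqt⟩⟩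
      · refine ENNReal.mul_ne_top (ENNReal.rpow_ne_top_of_nonneg ?_ (hA_ne_top _ _)) (cw_ne _ _ _)
        have h1 : 0 ≤ p - 1 := by linarith
        have h2 : 0 ≤ q.toReal - p := by linarith
        positivity
      · have h := schur3 (muN N) (hk (s + 1)) (hk_meas _) (hk_le_one hβ) _ (hk_int_right hN hβ)
          (hk_int_left hN hβ) (Fout s D) (Fout_meas s hD) p q.toReal hp hpq
        rw [mul_assoc]
        refine h.trans ?_
        gcongr
        exact Fout_bound s p hp hD
  obtain ⟨C, hC, h⟩ := hex
  refine ⟨C, hC, fun D hD => ⟨_, ?_, ?_, tr_eLp q hq1 (wout s D) (wout_meas s hD) _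
    (h D hD).1 (h D hD).2⟩⟩
  · have := wout_meas s hD
    fun_prop
  · filter_upwards [aux_ae_pos hN] with x hx
    refine le_trans ?_ (mul_le_mul_right (wout_pt s hD hx) _)
    rw [← mul_assoc, ← ENNReal.ofReal_mul (by positivity), ← Real.rpow_add hx]
    gcongr
    unfold wt
    have h0 : 0 ≤ (N : ℝ) / q.toReal := by positivity
    refine (Real.rpow_le_rpow_of_nonpos hx (by linarith) (by linarith)).trans_eq ?_
    congr 1; ring

lemma wt_le_one {N : ℕ} {s : ℝ} (hs : -1 < s) (q : ℝ≥0∞) (x : Euc N) : wt N (s + 1) q x ≤ 1 := by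
  unfold wt
  have h0 : 0 ≤ (N : ℝ) / q.toReal := by positivity
  exact Real.rpow_le_one_of_one_le_of_nonpos (by linarith [norm_nonneg x]) (by linarith)

lemma wt_nonneg {N : ℕ} (s : ℝ) (q : ℝ≥0∞) (x : Euc N) : 0 ≤ wt N s q x := by
  unfold wt; positivity

lemma wt_meas (N : ℕ) (s : ℝ) (q : ℝ≥0∞) : Measurable (wt N s q) := by
  unfold wt; fun_prop

lemma wt_eLp {N : ℕ} {s : ℝ} (hs : -1 < s) {q : ℝ≥0∞} (hq1 : 1 ≤ q) :
    eLpNorm (fun x : Euc N => ENNReal.ofReal (wt N (s + 1) q x)) q volume ≠ ∞ := by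
  have hq0 : q ≠ 0 := (lt_of_lt_of_le one_pos hq1).ne'
  by_cases hqt : q = ∞
  · subst hqt
    rw [eLpNorm_exponent_top, eLpNormEssSup]
    refine ((essSup_le_of_ae_le 1 (Eventually.of_forall fun x => ?_)).trans_lt ENNReal.one_lt_top).ne
    simpa using wt_le_one hs ∞ x
  · have hr : 0 < q.toReal := ENNReal.toReal_pos hq0 hqt
    rw [eLpNorm_eq_lintegral_rpow_enorm_toReal hq0 hqt]
    refine ENNReal.rpow_ne_top_of_nonneg (by positivity) ?_
    have hfin : Module.finrank ℝ (Euc N) = N := by simp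
    have := finite_integral_one_add_norm (E := Euc N) (μ := volume)
      (r := (s + 1) * q.toReal + N) (by rw [hfin]; nlinarith)
    refine ne_of_eq_of_ne (lintegral_congr fun x => ?_) this.ne
    rw [enorm_eq_self, ENNReal.ofReal_rpow_of_nonneg (wt_nonneg _ _ _) hr.le, wt,
      ← Real.rpow_mul (by positivity)]
    congr 2
    field_simp
    ring

lemma eLp_const_mul {N : ℕ} {q : ℝ≥0∞} (hq1 : 1 ≤ q) (b : ℝ≥0∞) (f : Euc N → ℝ≥0∞)
    (hf : Measurable f) :
    eLpNorm (fun x => b * f x) q volume = b * eLpNorm f q volume := by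
  have hq0 : q ≠ 0 := (lt_of_lt_of_le one_pos hq1).ne'
  by_cases hqt : q = ∞
  · subst hqt
    rw [eLpNorm_exponent_top, eLpNormEssSup, eLpNorm_exponent_top, eLpNormEssSup]
    simp only [enorm_eq_self]
    exact ENNReal.essSup_const_mul
  · have hr : 0 < q.toReal := ENNReal.toReal_pos hq0 hqt
    rw [eLpNorm_eq_lintegral_rpow_enorm_toReal hq0 hqt, eLpNorm_eq_lintegral_rpow_enorm_toReal hq0 hqt]
    simp only [enorm_eq_self, ENNReal.mul_rpow_of_nonneg _ _ hr.le]
    rw [lintegral_const_mul _ (hf.pow_const _), ENNReal.mul_rpow_of_nonneg _ _ (by positivity),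
      ← ENNReal.rpow_mul, mul_one_div_cancel hr.ne', ENNReal.rpow_one]

lemma est_const {N : ℕ} {s p : ℝ} (hs : -1 < s) {q : ℝ≥0∞} (hq1 : 1 ≤ q)
    (b : (Euc N → ℝ≥0∞) → ℝ≥0∞)
    (hb : ∃ C : ℝ≥0∞, C ≠ ∞ ∧ ∀ D, Measurable D → b D ≤ C * Mp N s p D) :
    Est N s p q (fun D _ => b D) := by
  obtain ⟨C, hC, h⟩ := hb
  have hw := wt_eLp (N := N) hs hq1
  refine ⟨C * eLpNorm (fun x : Euc N => ENNReal.ofReal (wt N (s + 1) q x)) q volume,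
    ENNReal.mul_ne_top hC hw, fun D hD => ?_⟩
  refine ⟨fun x => b D * ENNReal.ofReal (wt N (s + 1) q x), ?_, ?_, ?_⟩
  · exact (wt_meas _ _ _).ennreal_ofReal.const_mul _
  · exact Eventually.of_forall fun x => (mul_comm _ _).le
  · rw [eLp_const_mul hq1 _ _ (wt_meas _ _ _).ennreal_ofReal, mul_right_comm]
    gcongr
    exact h D hD

lemma est_bin {N : ℕ} (hN : 1 ≤ N) {s p : ℝ} (hs : -1 < s) (hp : 1 ≤ p) {q : ℝ≥0∞} (hq1 : 1 ≤ q) :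
    Est N s p q (fun D _ => Bin D) := by
  refine est_const hs hq1 _ ?_
  have hNpos : (0 : ℝ) < N := by exact_mod_cast hN
  obtain ⟨C, hC, h⟩ := ball_int hN s p 0 hp (by
    rcases hp.eq_or_lt with h | h
    · exact Or.inr ⟨h.symm, rfl⟩
    · left
      have : (N : ℝ) / p < N := div_lt_self hNpos h
      linarith)
  refine ⟨C, hC, fun D hD => ?_⟩
  simpa [Bin] using h D hD

lemma Est.mono {N : ℕ} {s p : ℝ} {q : ℝ≥0∞} {T S : (Euc N → ℝ≥0∞) → Euc N → ℝ≥0∞}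
    (hS : Est N s p q S) (h : ∀ D x, T D x ≤ S D x) : Est N s p q T := by
  obtain ⟨C, hC, h'⟩ := hS
  refine ⟨C, hC, fun D hD => ?_⟩
  obtain ⟨f, hf, hf1, hf2⟩ := h' D hD
  exact ⟨f, hf, hf1.mono fun x hx => le_trans (by gcongr; exact h D x) hx, hf2⟩

lemma est_in_top {N : ℕ} (hN : 1 ≤ N) {s p : ℝ} (hs : -1 < s) (hp : 1 ≤ p) {q : ℝ≥0∞}
    (hq1 : 1 ≤ q) (hNp : (N : ℝ) < p ∨ (p = 1 ∧ N = 1)) : Est N s p q Tin := by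
  have hNpos : (0 : ℝ) < N := by exact_mod_cast hN
  have hE : Est N s p q (fun D _ => ∫⁻ y in {y : Euc N | ‖y‖ ≤ 1},
      D y * ENNReal.ofReal (‖y‖ ^ (-((N : ℝ) - 1)))) := by
    refine est_const hs hq1 _ (ball_int hN s p ((N : ℝ) - 1) hp ?_)
    rcases hNp with h | ⟨h1, h2⟩
    · left
      have : (N : ℝ) / p < 1 := by rw [div_lt_one (by linarith)]; exact h
      linarith
    · right
      exact ⟨h1, by rw [h2]; simp⟩
  refine hE.mono fun D x => ?_
  rw [Tin, neg_sub]
  exact lintegral_mono_set fun y hy => hy.2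

lemma est_in {N : ℕ} (hN : 1 ≤ N) {s p : ℝ} (hs : -1 < s) (hp : 1 ≤ p) {q : ℝ≥0∞}
    (hqt : q ≠ ∞) (hq : ENNReal.ofReal p ≤ q) (hNq : (N : ℝ) / p ≤ 1 + N / q.toReal) :
    Est N s p q Tin := by
  have hNpos : (0 : ℝ) < N := by exact_mod_cast hN
  have hp0 : 0 < p := by linarith
  have hq1 : 1 ≤ q := le_trans (by simpa using hp) hq
  have hq0 : q ≠ 0 := (lt_of_lt_of_le one_pos hq1).ne'
  have hr : 0 < q.toReal := ENNReal.toReal_pos hq0 hqt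
  have hpq : p ≤ q.toReal := (ENNReal.ofReal_le_iff_le_toReal hqt).1 hq
  set α : ℝ := N / q.toReal with hα
  have hα0 : 0 < α := by positivity
  refine ⟨hA N α ^ (((p - 1) / p * (q.toReal - p) + p) / q.toReal) * cw N s p, ?_, fun D hD =>
    ⟨_, ?_, ?_, tr_eLp q hq1 (win α D) (win_meas α hD) _ (fun _ => ?_) (fun h => absurd h hqt)⟩⟩
  · refine ENNReal.mul_ne_top (ENNReal.rpow_ne_top_of_nonneg ?_ (hA_ne_top _ _)) (cw_ne _ _ _)
    have h1 : 0 ≤ p - 1 := by linarith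
    have h2 : 0 ≤ q.toReal - p := by linarith
    positivity
  · have := win_meas α hD
    fun_prop
  · filter_upwards [aux_ae_pos hN] with x hx
    refine le_trans ?_ (mul_le_mul_right (win_pt α hD hx) _)
    rw [← mul_assoc, ← ENNReal.ofReal_mul (by positivity), ← Real.rpow_add hx, ← hα]
    gcongr
    simpa using wt_le_one hs q x
  · have h := schur3 (muN N) (fun x y => hk α y x) (hk_meas_swap _) (fun x y => hk_le_one hα0 y x) _
      (hk_int_left hN hα0) (hk_int_right hN hα0) (Finn (1 + α) D) (Finn_meas _ hD) p q.toReal hp hpq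
    rw [mul_assoc]
    refine h.trans ?_
    gcongr
    exact Finn_bound hN s p _ hp hNq hD

lemma Ijp_cases {N : ℕ} (hN : 1 ≤ N) {p : ℝ} (hp : 1 ≤ p) {q : ℝ≥0∞} (hq : q ∈ Ijp N 1 p) :
    ENNReal.ofReal p ≤ q ∧ ((q ≠ ∞ ∧ (N : ℝ) / p ≤ 1 + N / q.toReal) ∨
      ((N : ℝ) < p ∨ (p = 1 ∧ N = 1))) := by
  have hNpos : (0 : ℝ) < N := by exact_mod_cast hN
  have hp0 : 0 < p := by linarith
  unfold Ijp at hq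
  simp only [Nat.cast_one, div_one, one_mul] at hq
  split_ifs at hq with h1 h2
  · refine ⟨hq.1, Or.inl ⟨hq.2.ne, ?_⟩⟩
    rw [h1.1, div_self hNpos.ne']
    have : 0 ≤ (N : ℝ) / q.toReal := by positivity
    linarith
  · have hqt : q ≠ ∞ := (hq.2.trans_lt ENNReal.ofReal_lt_top).ne
    refine ⟨hq.1, Or.inl ⟨hqt, ?_⟩⟩
    have hd : 0 < (N : ℝ) - p := by linarith
    have hpq : p ≤ q.toReal := (ENNReal.ofReal_le_iff_le_toReal hqt).1 hq.1
    have h3 : q.toReal ≤ N * p / (N - p) := ENNReal.toReal_le_of_le_ofReal (by positivity) hq.2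
    have hr : 0 < q.toReal := by linarith
    have h4 : N / (N * p / (N - p)) ≤ N / q.toReal := by gcongr
    have h5 : N / (N * p / (N - p)) = N / p - 1 := by field_simp
    linarith
  · refine ⟨hq.1, Or.inr ?_⟩
    rcases (not_lt.1 h2).eq_or_lt with h | h
    · right
      have : ¬ 1 < N := fun h' => h1 ⟨h.symm, h'⟩
      have hN1 : N = 1 := by omega
      exact ⟨by rw [← h, hN1]; simp, hN1⟩
    · exact Or.inl h

lemma est_all {N : ℕ} (hN : 1 ≤ N) {s p : ℝ} (hs : -1 < s) (hp : 1 ≤ p) {q : ℝ≥0∞}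
    (hq : q ∈ Ijp N 1 p) : Est N s p q (fun D x => Tout D x + Tin D x + Bin D) := by
  obtain ⟨h1, h2⟩ := Ijp_cases hN hp hq
  have hq1 : 1 ≤ q := le_trans (by simpa using hp) h1
  refine Est.add hq1 (Est.add hq1 (est_out hN hs hp h1) ?_) (est_bin hN hs hp hq1)
  rcases h2 with ⟨ha, hb⟩ | h
  · exact est_in hN hs hp ha h1 hb
  · exact est_in_top hN hs hp hq1 h

lemma self_mem_Ijp {N : ℕ} (hN : 1 ≤ N) {p : ℝ} (hp : 1 ≤ p) : ENNReal.ofReal p ∈ Ijp N 1 p := by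
  have hNpos : (0 : ℝ) < N := by exact_mod_cast hN
  unfold Ijp
  simp only [Nat.cast_one, div_one, one_mul]
  split_ifs with h1 h2
  · exact ⟨le_rfl, ENNReal.ofReal_lt_top⟩
  · refine ⟨le_rfl, ENNReal.ofReal_le_ofReal ?_⟩
    rw [le_div_iff₀ (by linarith)]
    nlinarith
  · exact ⟨le_rfl, le_top⟩

lemma Mp_eq {N : ℕ} {s p : ℝ} (hp : 1 ≤ p) {D : Euc N → ℝ≥0∞} {g : Fin N → Euc N → ℝ}
    (hD : D =ᵐ[volume] Dg g) :
    Mp N s p D = eLpNorm (fun x => wt N s (ENNReal.ofReal p) x * gradNorm1 g x)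
      (ENNReal.ofReal p) volume := by
  have hp0 : 0 < p := by linarith
  rw [eLpNorm_eq_lintegral_rpow_enorm_toReal (by simpa using hp0) ENNReal.ofReal_ne_top,
    ENNReal.toReal_ofReal hp0.le, Mp]
  congr 1
  refine lintegral_congr_ae ?_
  filter_upwards [hD] with x hx
  have h1 : 0 ≤ gradNorm1 g x := Real.sqrt_nonneg _
  rw [hx, Dg, ← ofReal_norm, norm_mul, Real.norm_of_nonneg (wt_nonneg _ _ _), Real.norm_of_nonneg h1,
    ENNReal.ofReal_mul (wt_nonneg _ _ _), wt, ENNReal.toReal_ofReal hp0.le]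

lemma grad_lt_top {N : ℕ} {s p : ℝ} (hp : 1 ≤ p) {g : Fin N → Euc N → ℝ}
    (hg : ∀ i, MemLs N s (ENNReal.ofReal p) (g i)) :
    eLpNorm (fun x => wt N s (ENNReal.ofReal p) x * gradNorm1 g x) (ENNReal.ofReal p) volume ≠ ∞ := by
  have h : MemLp (fun x => ∑ i, ‖wt N s (ENNReal.ofReal p) x * g i x‖) (ENNReal.ofReal p) volume :=
    memLp_finsetSum _ fun i _ => (hg i).norm
  refine ((eLpNorm_mono (g := fun x => ∑ i, ‖wt N s (ENNReal.ofReal p) x * g i x‖) ?_).trans_lt h.2).ne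
  intro x
  have h1 : gradNorm1 g x ≤ ∑ i, |g i x| := by
    unfold gradNorm1
    refine Real.sqrt_le_iff.2 ⟨by positivity, ?_⟩
    have := Finset.sum_sq_le_sq_sum_of_nonneg (s := Finset.univ) (f := fun i => |g i x|) (fun i _ => abs_nonneg _)
    simpa using this
  have h0 : 0 ≤ gradNorm1 g x := Real.sqrt_nonneg _
  rw [norm_mul, Real.norm_of_nonneg (wt_nonneg _ _ _), Real.norm_of_nonneg h0,
    Real.norm_of_nonneg (by positivity)]
  simp only [norm_mul, Real.norm_of_nonneg (wt_nonneg _ _ _), ← Finset.mul_sum, Real.norm_eq_abs]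
  exact mul_le_mul_of_nonneg_left h1 (wt_nonneg _ _ _)

lemma main1 {N : ℕ} (hN : 1 ≤ N) {s p : ℝ} (hs : -1 < s) (hp : 1 ≤ p) {q : ℝ≥0∞}
    (hq : q ∈ Ijp N 1 p) {c0 : ℝ≥0∞} (hc0 : c0 ≠ ∞) : ∃ C : ℝ≥0∞, C ≠ ∞ ∧
    ∀ (u : Euc N → ℝ) (D : Euc N → ℝ≥0∞) (a : ℝ), Measurable D →
      (∀ᵐ x, ‖u x - a‖ₑ ≤ c0 * (Tout D x + Tin D x + Bin D)) →
      eLpNorm (fun x => wt N (s + 1) q x * (u x - a)) q volume ≤ C * Mp N s p D := by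
  obtain ⟨C, hC, h⟩ := est_all hN hs hp hq
  have hq1 : 1 ≤ q := le_trans (by simpa using hp) (Ijp_cases hN hp hq).1
  refine ⟨c0 * C, ENNReal.mul_ne_top hc0 hC, fun u D a hD hu => ?_⟩
  obtain ⟨f, hf, hf1, hf2⟩ := h D hD
  calc _ ≤ eLpNorm (fun x => c0 * f x) q volume := by
        refine eLpNorm_mono_enorm_ae ?_
        filter_upwards [hu, hf1] with x h1 h2
        rw [enorm_mul, ← ofReal_norm (wt N (s + 1) q x), Real.norm_of_nonneg (wt_nonneg _ _ _),
          enorm_eq_self]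
        calc _ ≤ ENNReal.ofReal (wt N (s + 1) q x) * (c0 * (Tout D x + Tin D x + Bin D)) := by gcongr
          _ = c0 * (ENNReal.ofReal (wt N (s + 1) q x) * (Tout D x + Tin D x + Bin D)) := by ring
          _ ≤ _ := by gcongr
    _ = c0 * eLpNorm f q volume := eLp_const_mul hq1 _ _ hf
    _ ≤ _ := by rw [mul_assoc]; gcongr

lemma wt_const_eLp {N : ℕ} (s : ℝ) (q : ℝ≥0∞) (b : ℝ) :
    eLpNorm (fun x : Euc N => wt N s q x * b) q volume =
      ‖b‖ₑ * eLpNorm (fun x : Euc N => ENNReal.ofReal (wt N s q x)) q volume := by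
  have h1 : (fun x : Euc N => wt N s q x * b) = b • (wt N s q) := by
    ext x; simp [mul_comm]
  rw [h1, eLpNorm_const_smul]
  congr 1
  refine eLpNorm_congr_enorm_ae (Eventually.of_forall fun x => ?_)
  rw [← ofReal_norm, Real.norm_of_nonneg (wt_nonneg _ _ _), enorm_eq_self]

lemma avg_bound {N : ℕ} {s p ρ : ℝ} (hs : -1 < s) (hp : 1 ≤ p) (hρ : 0 < ρ) :
    ∃ K : ℝ≥0∞, K ≠ ∞ ∧ ∀ (u : Euc N → ℝ) (a : ℝ), LocallyIntegrable u volume →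
      ‖a - ballAvg ρ u‖ₑ ≤ K * eLpNorm (fun x => wt N (s + 1) (ENNReal.ofReal p) x * (u x - a))
        (ENNReal.ofReal p) volume := by
  have hp0 : 0 < p := by linarith
  set V := (volume (ball (0 : Euc N) ρ)) with hV
  have hV0 : V ≠ 0 := (measure_ball_pos _ _ hρ).ne'
  have hVt : V ≠ ∞ := measure_ball_lt_top.ne
  have hVr : 0 < V.toReal := ENNReal.toReal_pos hV0 hVt
  set e : ℝ := -(s + 1) - (N : ℝ) / p with he
  have hNp : 0 ≤ (N : ℝ) / p := by positivity
  set c : ℝ := (1 + ρ) ^ (-e) with hc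
  have hc0 : 0 < c := by positivity
  set P := ENNReal.ofReal p with hP
  have hP1 : 1 ≤ P := by simpa [hP] using hp
  refine ⟨‖V.toReal⁻¹‖ₑ * ‖c‖ₑ * V ^ (1 / (1 : ℝ≥0∞).toReal - 1 / P.toReal), ?_, ?_⟩
  · refine ENNReal.mul_ne_top (ENNReal.mul_ne_top enorm_ne_top enorm_ne_top) ?_
    exact ENNReal.rpow_ne_top_of_ne_zero hV0 hVt
  intro u a hu
  have huI : IntegrableOn u (ball 0 ρ) volume :=
    (hu.integrableOn_isCompact (isCompact_closedBall (0 : Euc N) ρ)).mono_set ball_subset_closedBall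
  have hcI : IntegrableOn (fun _ : Euc N => a) (ball 0 ρ) volume :=
    integrableOn_const hVt
  have e1 : a - ballAvg ρ u = -(V.toReal⁻¹ * ∫ y in ball (0 : Euc N) ρ, (u y - a)) := by
    rw [integral_sub huI hcI, ballAvg, ← hV]
    simp only [integral_const, smul_eq_mul, MeasurableSet.univ, measureReal_restrict_apply,
      Set.univ_inter]
    rw [measureReal_def, ← hV]
    field_simp
    ring
  rw [e1, enorm_neg, enorm_mul]
  have hmeas : AEStronglyMeasurable (fun y => u y - a) (volume.restrict (ball (0 : Euc N) ρ)) :=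
    huI.aestronglyMeasurable.sub aestronglyMeasurable_const
  have h1 : ‖∫ y in ball (0 : Euc N) ρ, (u y - a)‖ₑ ≤
      eLpNorm (fun y => u y - a) 1 (volume.restrict (ball (0 : Euc N) ρ)) := by
    rw [eLpNorm_one_eq_lintegral_enorm]
    exact enorm_integral_le_lintegral_enorm _
  have h2 := eLpNorm_le_eLpNorm_mul_rpow_measure_univ hP1 hmeas
  rw [Measure.restrict_apply_univ, ← hV] at h2
  have h3 : eLpNorm (fun y => u y - a) P (volume.restrict (ball (0 : Euc N) ρ)) ≤
      ‖c‖ₑ * eLpNorm (fun x => wt N (s + 1) P x * (u x - a)) P volume := by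
    calc _ ≤ eLpNorm (c • fun x => wt N (s + 1) P x * (u x - a)) P
          (volume.restrict (ball (0 : Euc N) ρ)) := by
          refine eLpNorm_mono_ae ?_
          filter_upwards [ae_restrict_mem measurableSet_ball] with x hx
          have hx1 : ‖x‖ < ρ := by simpa using hx
          have hw : 1 ≤ c * wt N (s + 1) P x := by
            rw [wt, hP, ENNReal.toReal_ofReal hp0.le, ← he, hc]
            calc (1 : ℝ) = (1 + ρ) ^ (-e) * (1 + ρ) ^ e := by
                  rw [← Real.rpow_add (by positivity)]; simp
              _ ≤ _ := by
                  gcongr (1 + ρ) ^ (-e) * ?_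
                  exact Real.rpow_le_rpow_of_nonpos (by positivity) (by linarith) (by linarith)
          simp only [Pi.smul_apply, smul_eq_mul]
          rw [← mul_assoc, norm_mul, Real.norm_of_nonneg (by linarith : 0 ≤ c * wt N (s + 1) P x)]
          exact le_mul_of_one_le_left (norm_nonneg _) hw
      _ ≤ eLpNorm (c • fun x => wt N (s + 1) P x * (u x - a)) P volume :=
          eLpNorm_restrict_le _ _ _ _
      _ = _ := eLpNorm_const_smul _ _ _ _
  calc _ ≤ ‖V.toReal⁻¹‖ₑ * ((‖c‖ₑ * eLpNorm (fun x => wt N (s + 1) P x * (u x - a)) P volume) *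
        V ^ (1 / (1 : ℝ≥0∞).toReal - 1 / P.toReal)) := by
        gcongr
        exact h1.trans (h2.trans (by gcongr))
    _ = _ := by ring

lemma part1 {N : ℕ} (hN : 1 ≤ N) (s p ρ : ℝ) (hs : -1 < s) (hp : 1 ≤ p) (hρ : 0 < ρ) :
    (∀ q ∈ Ijp N 1 p, ∃ C : ℝ, 0 < C ∧
      ∀ (u : Euc N → ℝ) (g : Fin N → Euc N → ℝ),
        (N = 1 ∨ RadSymm u) →
        (∀ i, IsWeakPartialDeriv i u (g i)) →
        (∀ i, MemLs N s (ENNReal.ofReal p) (g i)) →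
        MemLs N (s + 1) q u ∧
          LsNorm N (s + 1) q (fun x => u x - ballAvg ρ u)
            ≤ C * LsNorm N s (ENNReal.ofReal p) (gradNorm1 g)) := by
  intro q hq
  have hq1 : 1 ≤ q := le_trans (by simpa using hp) (Ijp_cases hN hp hq).1
  obtain ⟨c0, hc0, hrep⟩ := rep_all hN
  obtain ⟨C1, hC1, h1⟩ := main1 hN hs hp hq hc0
  obtain ⟨C2, hC2, h2⟩ := main1 hN hs hp (self_mem_Ijp hN hp) hc0
  obtain ⟨K, hK, hav⟩ := avg_bound (N := N) hs hp hρ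
  have hW := wt_eLp (N := N) hs hq1
  set W := eLpNorm (fun x : Euc N => ENNReal.ofReal (wt N (s + 1) q x)) q volume with hWd
  set T : ℝ≥0∞ := C1 + K * C2 * W with hT
  have hTt : T ≠ ∞ := ENNReal.add_ne_top.2 ⟨hC1, ENNReal.mul_ne_top (ENNReal.mul_ne_top hK hC2) hW⟩
  refine ⟨T.toReal + 1, by positivity, fun u g hor hg hgL => ?_⟩
  obtain ⟨D, hD, hDg, a, ha⟩ := hrep u g hor hg
  have hu : LocallyIntegrable u volume := (hg ⟨0, hN⟩).1
  have hum : AEStronglyMeasurable u volume := hu.aestronglyMeasurable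
  have hM : Mp N s p D ≠ ∞ := by rw [Mp_eq hp hDg]; exact grad_lt_top hp hgL
  have hm : AEStronglyMeasurable (fun x => wt N (s + 1) q x * (u x - a)) volume :=
    (wt_meas _ _ _).aestronglyMeasurable.mul (hum.sub aestronglyMeasurable_const)
  have hmc : ∀ b : ℝ, AEStronglyMeasurable (fun x => wt N (s + 1) q x * b) volume := fun b =>
    (wt_meas _ _ _).aestronglyMeasurable.mul aestronglyMeasurable_const
  have hsplit : ∀ b : ℝ, eLpNorm (fun x => wt N (s + 1) q x * (u x - a + b)) q volume ≤
      C1 * Mp N s p D + ‖b‖ₑ * W := by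
    intro b
    have e : (fun x => wt N (s + 1) q x * (u x - a + b)) =
        (fun x => wt N (s + 1) q x * (u x - a)) + fun x => wt N (s + 1) q x * b := by
      ext x; simp [mul_add]
    rw [e]
    refine (eLpNorm_add_le hm (hmc b) hq1).trans ?_
    rw [wt_const_eLp]
    gcongr
    exact h1 u D a hD ha
  constructor
  · refine ⟨(wt_meas _ _ _).aestronglyMeasurable.mul hum, ?_⟩
    have := hsplit a
    simp only [sub_add_cancel] at this
    refine this.trans_lt (ENNReal.add_lt_top.2 ⟨?_, ?_⟩)
    · exact ENNReal.mul_lt_top hC1.lt_top hM.lt_top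
    · exact ENNReal.mul_lt_top enorm_lt_top hW.lt_top
  · have h3 := hsplit (a - ballAvg ρ u)
    simp only [sub_add_sub_cancel] at h3
    have h4 : ‖a - ballAvg ρ u‖ₑ ≤ K * (C2 * Mp N s p D) :=
      (hav u a hu).trans (by gcongr; exact h2 u D a hD ha)
    have h5 : eLpNorm (fun x => wt N (s + 1) q x * (u x - ballAvg ρ u)) q volume ≤
        T * Mp N s p D := by
      refine h3.trans ?_
      calc _ ≤ C1 * Mp N s p D + K * (C2 * Mp N s p D) * W := by gcongr
        _ = _ := by rw [hT]; ring
    rw [Mp_eq hp hDg] at h5 hM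
    unfold LsNorm
    have h6 := ENNReal.toReal_mono (ENNReal.mul_ne_top hTt hM) h5
    rw [ENNReal.toReal_mul] at h6
    refine h6.trans ?_
    gcongr
    linarith

lemma hk_tendsto {N : ℕ} {β : ℝ} (hβ : 0 < β) (y : Euc N) :
    Tendsto (fun x : Euc N => hk β x y) (cocompact (Euc N)) (𝓝 0) := by
  have h1 : Tendsto (fun x : Euc N => ‖y‖ / ‖x‖) (cocompact (Euc N)) (𝓝 0) :=
    (tendsto_norm_cocompact_atTop (E := Euc N)).const_div_atTop ‖y‖
  have h2 : Tendsto (fun x : Euc N => ENNReal.ofReal ((‖y‖ / ‖x‖) ^ β)) (cocompact (Euc N)) (𝓝 0) := by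
    have h3 := (h1.rpow_const (p := β) (Or.inr hβ.le))
    rw [Real.zero_rpow hβ.ne'] at h3
    simpa using ENNReal.tendsto_ofReal h3
  refine tendsto_of_tendsto_of_tendsto_of_le_of_le tendsto_const_nhds h2 (fun _ => zero_le) fun x => ?_
  simp only [hk]
  split_ifs
  · exact le_rfl
  · exact zero_le

lemma wout_tendsto {N : ℕ} (hN : 1 ≤ N) {s p : ℝ} (hs : -1 < s) (hp : 1 ≤ p) {D : Euc N → ℝ≥0∞}
    (hD : Measurable D) (hM : Mp N s p D ≠ ∞) :
    Tendsto (fun x : Euc N => wout s D x) (cocompact (Euc N)) (𝓝 0) := by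
  have hβ : 0 < s + 1 := by linarith
  have hp0 : 0 < p := by linarith
  have hF := Fout_meas s hD
  have hfin : ∫⁻ y, Fout s D y ^ p ∂(muN N) ≠ ∞ := by
    intro h
    have hb := Fout_bound s p hp hD
    rw [h, ENNReal.top_rpow_of_pos (by positivity)] at hb
    exact ENNReal.mul_ne_top (cw_ne N s p) hM (top_le_iff.1 hb)
  have hcg : (cocompact (Euc N)).IsCountablyGenerated := by
    rw [← Metric.cobounded_eq_cocompact, ← comap_norm_atTop]
    infer_instance
  have hI : Tendsto (fun x : Euc N => ∫⁻ y, hk (s + 1) x y * Fout s D y ^ p ∂(muN N))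
      (cocompact (Euc N)) (𝓝 0) := by
    have h := tendsto_lintegral_filter_of_dominated_convergence (μ := muN N)
      (l := cocompact (Euc N)) (F := fun x y => hk (s + 1) x y * Fout s D y ^ p)
      (f := fun _ => 0) (fun y => Fout s D y ^ p)
      (Eventually.of_forall fun x => (hk_meas_left _ x).mul (hF.pow_const p))
      (Eventually.of_forall fun x => Eventually.of_forall fun y => by
        simpa using mul_le_mul_left (hk_le_one hβ x y) (Fout s D y ^ p)) hfin ?_
    · simpa using h
    · filter_upwards [ae_lt_top (hF.pow_const p) hfin] with y hy
      simpa using ENNReal.Tendsto.mul_const (hk_tendsto hβ y) (Or.inr hy.ne)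
  have hI2 := ENNReal.Tendsto.const_mul (a := hA N (s + 1) ^ (p - 1)) hI
    (Or.inr (ENNReal.rpow_ne_top_of_nonneg (by linarith) (hA_ne_top _ _)))
  have hI3 := hI2.ennrpow_const (1 / p)
  rw [mul_zero, ENNReal.zero_rpow_of_pos (by positivity)] at hI3
  refine tendsto_of_tendsto_of_tendsto_of_le_of_le tendsto_const_nhds hI3 (fun _ => zero_le) fun x => ?_
  have h := schur1 (muN N) (hk (s + 1)) (hk_meas _) (hk_le_one hβ) _ (hk_int_right hN hβ)
    (Fout s D) hF p hp x
  have h2 := ENNReal.rpow_le_rpow h (z := 1 / p) (by positivity)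
  rw [← ENNReal.rpow_mul, mul_one_div_cancel hp0.ne', ENNReal.rpow_one] at h2
  exact h2

lemma part2 {N : ℕ} (hN : 1 ≤ N) (s p : ℝ) (hs : -1 < s) (hp : 1 ≤ p)
    (u : Euc N → ℝ) (g : Fin N → Euc N → ℝ) (hor : N = 1 ∨ RadSymm u)
    (hg : ∀ i, IsWeakPartialDeriv i u (g i))
    (hgL : ∀ i, MemLs N s (ENNReal.ofReal p) (g i)) :
    ∃ v : Euc N → ℝ, v =ᵐ[volume] u ∧
      Tendsto (fun x : Euc N => ‖x‖ ^ (-(s + 1)) * v x) (cocompact (Euc N)) (nhds 0) := by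
  classical
  have hNpos : (0 : ℝ) < N := by exact_mod_cast hN
  obtain ⟨c0, hc0, hrep⟩ := rep_all hN
  obtain ⟨D, hD, hDg, a, ha⟩ := hrep u g hor hg
  have hM : Mp N s p D ≠ ∞ := by rw [Mp_eq hp hDg]; exact grad_lt_top hp hgL
  have hB : Bin D ≠ ∞ := by
    obtain ⟨C, hC, h⟩ := ball_int hN s p 0 hp (by
      rcases hp.eq_or_lt with h | h
      · exact Or.inr ⟨h.symm, rfl⟩
      · left
        rw [sub_pos]
        exact div_lt_self hNpos h)
    have h2 : Bin D ≤ C * Mp N s p D := by simpa [Bin] using h D hD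
    exact ne_top_of_le_ne_top (ENNReal.mul_ne_top hC hM) h2
  set bd : Euc N → ℝ≥0∞ := fun x =>
    ENNReal.ofReal (‖x‖ ^ (-(s + 1))) * (‖a‖ₑ + c0 * Bin D) + c0 * wout s D x with hbd
  have hbt : Tendsto bd (cocompact (Euc N)) (𝓝 0) := by
    have h1 : Tendsto (fun x : Euc N => ENNReal.ofReal (‖x‖ ^ (-(s + 1)))) (cocompact (Euc N)) (𝓝 0) := by
      have := ENNReal.tendsto_ofReal ((tendsto_rpow_neg_atTop (y := s + 1) (by linarith)).comp
        (tendsto_norm_cocompact_atTop (E := Euc N)))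
      simpa using this
    have h2 := ENNReal.Tendsto.mul_const (b := ‖a‖ₑ + c0 * Bin D) h1
      (Or.inr (ENNReal.add_ne_top.2 ⟨enorm_ne_top, ENNReal.mul_ne_top hc0 hB⟩))
    have h3 := ENNReal.Tendsto.const_mul (wout_tendsto hN hs hp hD hM) (Or.inr hc0)
    have h4 := h2.add h3
    rw [zero_mul, mul_zero, add_zero] at h4
    exact h4
  have hae : ∀ᵐ x : Euc N, 1 < ‖x‖ → ‖‖x‖ ^ (-(s + 1)) * u x‖ₑ ≤ bd x := by
    filter_upwards [ha] with x hx h1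
    have hx0 : 0 < ‖x‖ := by linarith
    have hT : Tin D x = 0 := by
      have : {y : Euc N | ‖x‖ ≤ ‖y‖ ∧ ‖y‖ ≤ 1} = ∅ := by
        ext y; simp only [Set.mem_ofPred_eq, Set.mem_empty_iff_false, iff_false]; intro h; linarith [h.1, h.2]
      simp [Tin, this]
    rw [hT, add_zero] at hx
    have hu : ‖u x‖ₑ ≤ ‖a‖ₑ + c0 * (Tout D x + Bin D) := by
      calc ‖u x‖ₑ = ‖a + (u x - a)‖ₑ := by congr 1; ring
        _ ≤ ‖a‖ₑ + ‖u x - a‖ₑ := enorm_add_le _ _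
        _ ≤ _ := by gcongr
    have hw := wout_pt s hD hx0
    rw [enorm_mul, Real.enorm_of_nonneg (by positivity)]
    calc _ ≤ ENNReal.ofReal (‖x‖ ^ (-(s + 1))) * (‖a‖ₑ + c0 * (Tout D x + Bin D)) := by gcongr
      _ = ENNReal.ofReal (‖x‖ ^ (-(s + 1))) * (‖a‖ₑ + c0 * Bin D) +
          c0 * (ENNReal.ofReal (‖x‖ ^ (-(s + 1))) * Tout D x) := by ring
      _ ≤ _ := by rw [hbd]; dsimp only; gcongr
  refine ⟨fun x => if 1 < ‖x‖ → ‖‖x‖ ^ (-(s + 1)) * u x‖ₑ ≤ bd x then u x else 0, ?_, ?_⟩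
  · filter_upwards [hae] with x hx
    rw [if_pos hx]
  · have hev : ∀ᶠ x in cocompact (Euc N), 1 < ‖x‖ :=
      (tendsto_norm_cocompact_atTop (E := Euc N)).eventually_gt_atTop 1
    rw [tendsto_zero_iff_enorm_tendsto_zero]
    refine tendsto_of_tendsto_of_tendsto_of_le_of_le' tendsto_const_nhds hbt
      (Eventually.of_forall fun _ => zero_le) ?_
    filter_upwards [hev] with x hx
    split_ifs with h
    · exact h hx
    · simp

/-- Theorem 3(ii). If `s > -1`, `1 ≤ p < ∞`, `∇u ∈ (L^p_s)^N` and
either `N = 1` or `u` is radially symmetric, then `u ∈ L^q_{s+1}` for every `q ∈ I_{1,p}`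
with `‖u - c_u‖_{L^q_{s+1}} ≤ C ‖|∇u|‖_{L^p_s}`, `c_u = |B_ρ|⁻¹ ∫_{B_ρ} u`; and if
`p > N` or `p = N = 1` then (a representative of) `u` satisfies
`|x|^{-(s+1)} u(x) → 0` as `|x| → ∞`. -/
theorem stmt_4 {N : ℕ} (hN : 1 ≤ N) (s p ρ : ℝ) (hs : -1 < s) (hp : 1 ≤ p) (hρ : 0 < ρ) :
    (∀ q ∈ Ijp N 1 p, ∃ C : ℝ, 0 < C ∧
      ∀ (u : Euc N → ℝ) (g : Fin N → Euc N → ℝ),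
        (N = 1 ∨ RadSymm u) →
        (∀ i, IsWeakPartialDeriv i u (g i)) →
        (∀ i, MemLs N s (ENNReal.ofReal p) (g i)) →
        MemLs N (s + 1) q u ∧
          LsNorm N (s + 1) q (fun x => u x - ballAvg ρ u)
            ≤ C * LsNorm N s (ENNReal.ofReal p) (gradNorm1 g)) ∧
    (((N : ℝ) < p ∨ (p = 1 ∧ N = 1)) →
      ∀ (u : Euc N → ℝ) (g : Fin N → Euc N → ℝ),
        (N = 1 ∨ RadSymm u) →
        (∀ i, IsWeakPartialDeriv i u (g i)) →
        (∀ i, MemLs N s (ENNReal.ofReal p) (g i)) →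
        ∃ v : Euc N → ℝ, v =ᵐ[volume] u ∧
          Tendsto (fun x : Euc N => ‖x‖ ^ (-(s + 1)) * v x) (cocompact (Euc N))
            (nhds 0)) := by
  exact ⟨part1 hN s p ρ hs hp hρ, fun _ u g hor hg hgL => part2 hN s p hs hp u g hor hg hgL⟩

end
end

section
/- Let N ≥ 1 be an integer, s < -1 and 1 ≤ p < ∞. For every finite q ∈ I_{1,p}, there is a constant C > 0 such that, for every locally absolutely continuous function f on (0,∞) with lim_{r→∞} f(r) = 0, (∫_0^∞ (1+r)^{-(s+1)q-N} r^{N-1} |f(r)|^q dr)^{1/q} ≤ C (∫_0^∞ (1+r)^{-sp-N} r^{N-1} |f'(r)|^p dr)^{1/p}. -/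
open MeasureTheory Metric Filter Topology ENNReal

noncomputable section

lemma jensen5 (H X g : ℝ → ℝ≥0∞) (hHm : Measurable H) (hXm : Measurable X) (hg : Measurable g)
    (p : ℝ) (hp : 1 ≤ p) (r : ℝ) 
    (hH : ∀ t, r < t → H t ≠ 0 ∧ H t ≠ ⊤) (hX : ∀ t, r < t → X t ≠ 0 ∧ X t ≠ ⊤) :
    (∫⁻ t in Set.Ioi r, g t) ^ p ≤ (∫⁻ t in Set.Ioi r, g t ^ p * (H t * X t) ^ (p-1)) *
      (∫⁻ t in Set.Ioi r, (H t * X t)⁻¹) ^ (p-1) := by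
  have hp0 : 0 < p := by linarith
  have key := ENNReal.lintegral_mul_norm_pow_le (μ := volume.restrict (Set.Ioi r))
    (f := fun t => g t ^ p * (H t * X t) ^ (p-1)) (g := fun t => (H t * X t)⁻¹)
    (by fun_prop) (by fun_prop) (p := 1/p) (q := 1 - 1/p) (by positivity)
    (by rw [sub_nonneg, div_le_one hp0]; exact hp) (by ring)
  have e : ∫⁻ t in Set.Ioi r, g t = ∫⁻ t in Set.Ioi r, 
      (g t ^ p * (H t * X t) ^ (p-1)) ^ (1/p) * ((H t * X t)⁻¹) ^ (1-1/p) := by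
    refine setLIntegral_congr_fun measurableSet_Ioi ?_
    intro t ht
    obtain ⟨h1, h2⟩ := hH t ht
    obtain ⟨h3, h4⟩ := hX t ht
    have h5 : H t * X t ≠ 0 := mul_ne_zero h1 h3
    have h6 : H t * X t ≠ ⊤ := ENNReal.mul_ne_top h2 h4
    simp only
    rw [ENNReal.mul_rpow_of_nonneg _ _ (by positivity), ← ENNReal.rpow_mul, ← ENNReal.rpow_mul,
      ENNReal.inv_rpow, ← ENNReal.rpow_neg, mul_assoc, ← ENNReal.rpow_add _ _ h5 h6]
    have : (p-1) * (1/p) + -(1-1/p) = 0 := by field_simp; ring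
    rw [this, mul_one_div_cancel hp0.ne']; simp
  rw [e]
  refine (ENNReal.rpow_le_rpow key hp0.le).trans (le_of_eq ?_)
  rw [ENNReal.mul_rpow_of_nonneg _ _ hp0.le, ← ENNReal.rpow_mul, ← ENNReal.rpow_mul]
  have : (1 - 1/p) * p = p - 1 := by field_simp
  rw [this, one_div_mul_cancel hp0.ne', ENNReal.rpow_one]

lemma hardy5 (H X : ℝ → ℝ≥0∞) (hHm : Measurable H) (hXm : Measurable X)
    (hH : ∀ t, 0 < t → H t ≠ 0 ∧ H t ≠ ⊤) (hX : ∀ t, 0 < t → X t ≠ 0 ∧ X t ≠ ⊤)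
    (hmono : ∀ r t, 0 < r → r < t → H r ≤ H t)
    (c : ℝ≥0∞) (hc : c ≠ ⊤)
    (L1 : ∀ r, 0 < r → ∫⁻ t in Set.Ioi r, (H t * X t)⁻¹ ≤ c * (H r)⁻¹)
    (L2 : ∀ t, 0 < t → ∫⁻ r in Set.Ioo 0 t, H r * (X r)⁻¹ ≤ c * H t)
    (p q : ℝ) (hp : 1 ≤ p) (hq : p ≤ q) :
    ∃ C : ℝ≥0∞, C ≠ ⊤ ∧ ∀ g : ℝ → ℝ≥0∞, Measurable g →
      ∫⁻ r in Set.Ioi 0, H r ^ q * (X r)⁻¹ * (∫⁻ t in Set.Ioi r, g t) ^ q ≤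
       C * (∫⁻ t in Set.Ioi 0, H t ^ p * X t ^ (p-1) * g t ^ p) ^ (q/p) := by
  have hp0 : 0 < p := by linarith
  have hqp : 0 ≤ q - p := by linarith
  refine ⟨(c ^ (p-1)) ^ ((q-p)/p) * (c ^ (p-1) * c), ?_, ?_⟩
  · refine ENNReal.mul_ne_top (ENNReal.rpow_ne_top_of_nonneg (by positivity)
      (ENNReal.rpow_ne_top_of_nonneg (by linarith) hc))
      (ENNReal.mul_ne_top (ENNReal.rpow_ne_top_of_nonneg (by linarith) hc) hc)
  intro g hg
  set B := ∫⁻ t in Set.Ioi 0, H t ^ p * X t ^ (p-1) * g t ^ p with hB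
  have hHX : ∀ t, 0 < t → g t ^ p * (H t * X t) ^ (p-1) = 
      (H t ^ p * X t ^ (p-1) * g t ^ p) * (H t)⁻¹ := by
    intro t ht
    rw [ENNReal.mul_rpow_of_nonneg _ _ (by linarith), ENNReal.rpow_sub _ _ (hH t ht).1 (hH t ht).2,
      ENNReal.rpow_one, div_eq_mul_inv]
    ring
  have J : ∀ r, 0 < r → (∫⁻ t in Set.Ioi r, g t) ^ p ≤ 
      (∫⁻ t in Set.Ioi r, g t ^ p * (H t * X t) ^ (p-1)) * (c * (H r)⁻¹) ^ (p-1) := by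
    intro r hr
    refine (jensen5 H X g hHm hXm hg p hp r (fun t ht => hH t (hr.trans ht))
      (fun t ht => hX t (hr.trans ht))).trans ?_
    gcongr
    exact L1 r hr
  -- pointwise
  have P : ∀ r, 0 < r → (H r * ∫⁻ t in Set.Ioi r, g t) ^ p ≤ c ^ (p-1) * B := by
    intro r hr
    have h1 : (∫⁻ t in Set.Ioi r, g t ^ p * (H t * X t) ^ (p-1)) ≤ B * (H r)⁻¹ := by
      calc _ ≤ ∫⁻ t in Set.Ioi r, (H t ^ p * X t ^ (p-1) * g t ^ p) * (H r)⁻¹ := by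
            refine setLIntegral_mono' measurableSet_Ioi fun t ht => ?_
            rw [hHX t (hr.trans ht)]
            gcongr
            exact hmono r t hr ht
        _ = (∫⁻ t in Set.Ioi r, (H t ^ p * X t ^ (p-1) * g t ^ p)) * (H r)⁻¹ := by
            rw [lintegral_mul_const]; fun_prop
        _ ≤ _ := by
            gcongr
            exact lintegral_mono_set (Set.Ioi_subset_Ioi hr.le)
    calc _ = H r ^ p * (∫⁻ t in Set.Ioi r, g t) ^ p := ENNReal.mul_rpow_of_nonneg _ _ hp0.le
      _ ≤ H r ^ p * ((B * (H r)⁻¹) * (c * (H r)⁻¹) ^ (p-1)) := by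
          gcongr
          refine (J r hr).trans ?_
          gcongr
      _ = (H r ^ p * (H r)⁻¹ ^ p) * (c ^ (p-1) * B) := by
          have : (H r)⁻¹ ^ p = (H r)⁻¹ * (H r)⁻¹ ^ (p-1) := by
            rw [ENNReal.rpow_sub _ _ (by simpa using (hH r hr).2) (by simpa using (hH r hr).1),
              ENNReal.rpow_one, ENNReal.mul_div_cancel (by simpa using (hH r hr).2) (by simpa using (hH r hr).1)]
          rw [this, ENNReal.mul_rpow_of_nonneg _ _ (by linarith)]
          ring
      _ = _ := by
          rw [← ENNReal.mul_rpow_of_nonneg _ _ hp0.le, ENNReal.mul_inv_cancel (hH r hr).1 (hH r hr).2]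
          simp
  -- p-p inequality
  have D : ∫⁻ r in Set.Ioi 0, H r ^ p * (X r)⁻¹ * (∫⁻ t in Set.Ioi r, g t) ^ p ≤ 
      c ^ (p-1) * c * B := by
    set G : ℝ → ℝ≥0∞ := fun t => g t ^ p * (H t * X t) ^ (p-1) with hG
    have hGm : Measurable G := by fun_prop
    calc _ ≤ ∫⁻ r in Set.Ioi 0, c ^ (p-1) * ∫⁻ t in Set.Ioi 0, 
              (Set.Ioi r).indicator (fun t => H r * (X r)⁻¹ * G t) t := by
          refine setLIntegral_mono' measurableSet_Ioi fun r hr => ?_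
          have hr' : (0:ℝ) < r := hr
          have : ∫⁻ t in Set.Ioi 0, (Set.Ioi r).indicator (fun t => H r * (X r)⁻¹ * G t) t 
              = H r * (X r)⁻¹ * ∫⁻ t in Set.Ioi r, G t := by
            rw [setLIntegral_indicator measurableSet_Ioi, Set.inter_eq_left.2 (Set.Ioi_subset_Ioi hr'.le),
              lintegral_const_mul _ hGm]
          rw [this]
          calc _ ≤ H r ^ p * (X r)⁻¹ * ((∫⁻ t in Set.Ioi r, G t) * (c * (H r)⁻¹) ^ (p-1)) := by
                gcongr
                exact J r hr'
            _ = (H r ^ p * (H r)⁻¹ ^ (p-1)) * ((X r)⁻¹ * c ^ (p-1) * ∫⁻ t in Set.Ioi r, G t) := by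
                rw [ENNReal.mul_rpow_of_nonneg _ _ (by linarith)]
                ring
            _ = H r * ((X r)⁻¹ * c ^ (p-1) * ∫⁻ t in Set.Ioi r, G t) := by
                rw [ENNReal.inv_rpow, ← ENNReal.rpow_neg, ← ENNReal.rpow_add _ _ (hH r hr).1 (hH r hr).2]
                simp
            _ = _ := by ring
            _ ≤ _ := le_rfl
      _ = c ^ (p-1) * ∫⁻ r in Set.Ioi 0, ∫⁻ t in Set.Ioi 0, 
              (Set.Ioi r).indicator (fun t => H r * (X r)⁻¹ * G t) t := by
          rw [lintegral_const_mul' _ _ (ENNReal.rpow_ne_top_of_nonneg (by linarith) hc)]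
      _ = c ^ (p-1) * ∫⁻ t in Set.Ioi 0, ∫⁻ r in Set.Ioi 0, 
              (Set.Ioi r).indicator (fun t => H r * (X r)⁻¹ * G t) t := by
          rw [lintegral_lintegral_swap]
          have : Function.uncurry (fun r t => (Set.Ioi r).indicator (fun t => H r * (X r)⁻¹ * G t) t) 
              = {x : ℝ × ℝ | x.1 < x.2}.indicator (fun x => H x.1 * (X x.1)⁻¹ * G x.2) := by
            ext ⟨x, y⟩
            simp [Set.indicator]
          rw [this]
          refine Measurable.aemeasurable (Measurable.indicator (by fun_prop) 
            (measurableSet_lt measurable_fst measurable_snd))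
      _ ≤ c ^ (p-1) * ∫⁻ t in Set.Ioi 0, c * (H t ^ p * X t ^ (p-1) * g t ^ p) := by
          gcongr _ * ?_
          refine setLIntegral_mono' measurableSet_Ioi fun t ht => ?_
          have ht' : (0:ℝ) < t := ht
          have : ∀ r, (Set.Ioi r).indicator (fun t => H r * (X r)⁻¹ * G t) t = 
            (Set.Iio t).indicator (fun r => H r * (X r)⁻¹ * G t) r := by
            intro r; simp [Set.indicator]
          simp_rw [this]
          rw [setLIntegral_indicator measurableSet_Iio, Set.inter_comm, Set.Ioi_inter_Iio,
            lintegral_mul_const _ (by fun_prop)]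
          calc _ ≤ c * H t * G t := by
                gcongr; exact L2 t ht
            _ = c * (H t ^ p * X t ^ (p-1) * g t ^ p) * (H t * (H t)⁻¹) := by
                simp only [hG]
                rw [hHX t ht]; ring
            _ = _ := by rw [ENNReal.mul_inv_cancel (hH t ht).1 (hH t ht).2, mul_one]
      _ = _ := by
          rw [lintegral_const_mul' _ _ hc, ← mul_assoc]
  calc _ ≤ ∫⁻ r in Set.Ioi 0, (c ^ (p-1) * B) ^ ((q-p)/p) * 
        (H r ^ p * (X r)⁻¹ * (∫⁻ t in Set.Ioi r, g t) ^ p) := by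
        refine setLIntegral_mono' measurableSet_Ioi fun r hr => ?_
        have hr' : (0:ℝ) < r := hr
        set F := ∫⁻ t in Set.Ioi r, g t
        have e1 : H r ^ q * (X r)⁻¹ * F ^ q = (H r * F) ^ (q-p) * (H r ^ p * (X r)⁻¹ * F ^ p) := by
          have : q = (q-p) + p := by ring
          rw [ENNReal.mul_rpow_of_nonneg _ _ hqp]
          conv_lhs => rw [this, ENNReal.rpow_add_of_nonneg _ _ hqp hp0.le, ENNReal.rpow_add_of_nonneg _ _ hqp hp0.le]
          ring
        rw [e1]
        gcongr
        have := ENNReal.rpow_le_rpow (P r hr') (z := (q-p)/p) (by positivity)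
        rwa [← ENNReal.rpow_mul, mul_div_cancel₀ _ hp0.ne'] at this
    _ ≤ (c ^ (p-1) * B) ^ ((q-p)/p) * (c ^ (p-1) * c * B) := by
        rw [lintegral_const_mul]
        · gcongr
        · have : Measurable fun r => ∫⁻ t in Set.Ioi r, g t := by
            have : Antitone fun r => ∫⁻ t in Set.Ioi r, g t := 
              fun a b hab => lintegral_mono_set (Set.Ioi_subset_Ioi hab)
            exact this.measurable
          fun_prop
    _ = _ := by
        have : q / p = (q-p)/p + 1 := by field_simp; ring
        rw [this, ENNReal.rpow_add_of_nonneg _ _ (by positivity) zero_le_one, ENNReal.rpow_one,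
          ENNReal.mul_rpow_of_nonneg _ _ (by positivity)]
        ring

def h5 (a S t : ℝ) : ℝ := t ^ a * (1 + t) ^ (S - a)

def d5 (a S t : ℝ) : ℝ := h5 a S t * (a / t + (S - a) / (1 + t))

lemma h5_pos (a S t : ℝ) (ht : 0 < t) : 0 < h5 a S t := by
  unfold h5; positivity

lemma h5_deriv (a S t : ℝ) (ht : 0 < t) : HasDerivAt (h5 a S) (d5 a S t) t := by
  have h1 : HasDerivAt (fun t : ℝ => t ^ a) (a * t ^ (a-1)) t := 
    Real.hasDerivAt_rpow_const (Or.inl ht.ne')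
  have h2 : HasDerivAt (fun t : ℝ => (1 + t) ^ (S-a)) (1 * (S-a) * (1+t) ^ (S-a-1)) t := 
    HasDerivAt.rpow_const ((hasDerivAt_id' t).const_add 1) (Or.inl (by positivity))
  have h3 := h1.mul h2
  refine h3.congr_deriv ?_
  unfold d5 h5
  rw [Real.rpow_sub_one ht.ne', Real.rpow_sub_one (by positivity)]
  field_simp

lemma d5_ge (a S t : ℝ) (ht : 0 < t) : min a S * (h5 a S t / t) ≤ d5 a S t := by
  unfold d5
  have h := h5_pos a S t ht
  have e : a / t + (S - a) / (1 + t) = ((a + S * t) / (1+t)) / t := by field_simp; ring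
  rw [e]
  have : min a S ≤ (a + S * t) / (1+t) := by
    rw [le_div_iff₀ (by positivity)]
    nlinarith [min_le_left a S, min_le_right a S]
  calc _ = h5 a S t * (min a S / t) := by ring
    _ ≤ _ := by gcongr

lemma h5_cont (a S : ℝ) (ha : 0 < a) : ContinuousOn (h5 a S) (Set.Ici 0) := by
  unfold h5
  refine ContinuousOn.mul (fun x hx => ?_) (fun x hx => ?_)
  · exact (Real.continuousAt_rpow_const _ _ (Or.inr ha.le)).continuousWithinAt
  · refine ContinuousAt.continuousWithinAt ?_
    refine ContinuousAt.rpow_const (by fun_prop) (Or.inl ?_)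
    have : (0:ℝ) ≤ x := hx
    positivity

lemma h5_tendsto (a S : ℝ) (hS : 0 < S) : 
    Tendsto (fun t => (h5 a S t)⁻¹) atTop (𝓝 0) := by
  have h1 : Tendsto (fun t : ℝ => (1 + t⁻¹) ^ a * (1 + t) ^ (-S)) atTop (𝓝 ((1+0)^a * 0)) := by
    refine Tendsto.mul ?_ ?_
    · refine Tendsto.rpow_const (tendsto_const_nhds.add tendsto_inv_atTop_zero) (Or.inl (by norm_num))
    · exact (tendsto_rpow_neg_atTop hS).comp (tendsto_atTop_add_const_left _ _ tendsto_id)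
  rw [mul_zero] at h1
  refine h1.congr' ?_
  filter_upwards [eventually_gt_atTop 0] with t ht
  unfold h5
  have : 1 + t⁻¹ = (1 + t) / t := by field_simp; ring
  rw [this, Real.div_rpow (by positivity) ht.le, Real.rpow_sub (by positivity), Real.rpow_neg (by positivity)]
  field_simp

lemma h5_mono (a S : ℝ) (ha : 0 < a) (hS : 0 < S) (r t : ℝ) (hr : 0 < r) (hrt : r < t) :
    h5 a S r ≤ h5 a S t := by
  have : MonotoneOn (h5 a S) (Set.Ici 0) := by
    refine monotoneOn_of_deriv_nonneg (convex_Ici 0) (h5_cont a S ha) ?_ ?_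
    · rw [interior_Ici]
      intro x hx
      exact (h5_deriv a S x hx).differentiableAt.differentiableWithinAt
    · rw [interior_Ici]
      intro x hx
      rw [(h5_deriv a S x hx).deriv]
      refine le_trans ?_ (d5_ge a S x hx)
      have := h5_pos a S x hx
      have : (0:ℝ) < x := hx
      positivity
  exact this hr.le (hr.trans hrt).le hrt.le

lemma h5_L2 (a S : ℝ) (ha : 0 < a) (hS : 0 < S) (t : ℝ) (ht : 0 < t) :
    ∫⁻ r in Set.Ioo 0 t, ENNReal.ofReal (h5 a S r) * (ENNReal.ofReal r)⁻¹ ≤ 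
      ENNReal.ofReal (1 / min a S) * ENNReal.ofReal (h5 a S t) := by
  have hm : 0 < min a S := lt_min ha hS
  have hd : ∀ x, 0 < x → 0 ≤ d5 a S x := by
    intro x hx
    refine le_trans ?_ (d5_ge a S x hx)
    have := h5_pos a S x hx
    positivity
  have hc : ContinuousOn (h5 a S) (Set.Icc 0 t) := (h5_cont a S ha).mono Set.Icc_subset_Ici_self
  have hi : IntegrableOn (d5 a S) (Set.Ioc 0 t) := 
    intervalIntegral.integrableOn_deriv_of_nonneg hc
      (fun x hx => h5_deriv a S x hx.1) (fun x hx => hd x hx.1)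
  have hI : ∫ x in (0:ℝ)..t, d5 a S x = h5 a S t - h5 a S 0 := 
    intervalIntegral.integral_eq_sub_of_hasDerivAt_of_le ht.le hc (fun x hx => h5_deriv a S x hx.1)
      ((intervalIntegrable_iff_integrableOn_Ioc_of_le ht.le).2 hi)
  have h0 : h5 a S 0 = 0 := by simp [h5, Real.zero_rpow ha.ne']
  rw [h0, sub_zero, intervalIntegral.integral_of_le ht.le] at hI
  calc _ ≤ ∫⁻ r in Set.Ioo 0 t, ENNReal.ofReal (1 / min a S) * ENNReal.ofReal (d5 a S r) := by
        refine setLIntegral_mono' measurableSet_Ioo fun r hr => ?_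
        rw [← ENNReal.ofReal_inv_of_pos hr.1, ← ENNReal.ofReal_mul (h5_pos a S r hr.1).le,
          ← ENNReal.ofReal_mul (by positivity)]
        refine ENNReal.ofReal_le_ofReal ?_
        rw [one_div, ← div_eq_inv_mul, le_div_iff₀ hm, mul_comm, ← div_eq_mul_inv]
        exact d5_ge a S r hr.1
    _ = ENNReal.ofReal (1 / min a S) * ∫⁻ r in Set.Ioo 0 t, ENNReal.ofReal (d5 a S r) := 
        lintegral_const_mul' _ _ ENNReal.ofReal_ne_top
    _ = ENNReal.ofReal (1 / min a S) * ∫⁻ r in Set.Ioc 0 t, ENNReal.ofReal (d5 a S r) := by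
        rw [setLIntegral_congr Ioo_ae_eq_Ioc]
    _ = _ := by
        rw [← ofReal_integral_eq_lintegral_ofReal hi, hI]
        filter_upwards [ae_restrict_mem measurableSet_Ioc] with x hx
        exact hd x hx.1

lemma h5_L1 (a S : ℝ) (ha : 0 < a) (hS : 0 < S) (r : ℝ) (hr : 0 < r) :
    ∫⁻ t in Set.Ioi r, (ENNReal.ofReal (h5 a S t) * ENNReal.ofReal t)⁻¹ ≤ 
      ENNReal.ofReal (1 / min a S) * (ENNReal.ofReal (h5 a S r))⁻¹ := by
  have hm : 0 < min a S := lt_min ha hS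
  have hd : ∀ x, 0 < x → 0 ≤ d5 a S x := by
    intro x hx
    refine le_trans ?_ (d5_ge a S x hx)
    have := h5_pos a S x hx
    positivity
  have hD : ∀ x ∈ Set.Ici r, HasDerivAt (fun t => -(h5 a S t)⁻¹) (d5 a S x / (h5 a S x)^2) x := by
    intro x hx
    have hx' : 0 < x := lt_of_lt_of_le hr hx
    refine ((h5_deriv a S x hx').inv (h5_pos a S x hx').ne').neg.congr_deriv ?_
    ring
  have hn : ∀ x ∈ Set.Ioi r, 0 ≤ d5 a S x / (h5 a S x)^2 := by
    intro x hx
    have := hd x (hr.trans hx)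
    positivity
  have hT := (h5_tendsto a S hS).neg
  have hi := integrableOn_Ioi_deriv_of_nonneg' hD hn hT
  have hI := integral_Ioi_of_hasDerivAt_of_nonneg' hD hn hT
  calc _ ≤ ∫⁻ t in Set.Ioi r, ENNReal.ofReal (1 / min a S) * ENNReal.ofReal (d5 a S t / (h5 a S t)^2) := by
        refine setLIntegral_mono' measurableSet_Ioi fun t ht => ?_
        have ht' : 0 < t := hr.trans ht
        have hp := h5_pos a S t ht'
        rw [← ENNReal.ofReal_mul hp.le, ← ENNReal.ofReal_inv_of_pos (by positivity),
          ← ENNReal.ofReal_mul (by positivity)]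
        refine ENNReal.ofReal_le_ofReal ?_
        rw [one_div, ← div_eq_inv_mul, le_div_iff₀ hm, le_div_iff₀ (by positivity)]
        refine le_trans (le_of_eq ?_) (d5_ge a S t ht')
        field_simp
    _ = ENNReal.ofReal (1 / min a S) * ∫⁻ t in Set.Ioi r, ENNReal.ofReal (d5 a S t / (h5 a S t)^2) := 
        lintegral_const_mul' _ _ ENNReal.ofReal_ne_top
    _ = _ := by
        rw [← ofReal_integral_eq_lintegral_ofReal hi, hI,
          ← ENNReal.ofReal_inv_of_pos (h5_pos a S r hr)]
        · simp
        filter_upwards [ae_restrict_mem measurableSet_Ioi] with x hx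
        exact hn x hx

lemma tail5 (f f' : ℝ → ℝ) (hf' : LocallyIntegrableOn f' (Set.Ioi 0) volume)
    (hf : ∀ r : ℝ, 0 < r → f r = f 1 + ∫ t in (1:ℝ)..r, f' t)
    (hlim : Tendsto f atTop (nhds 0)) (r : ℝ) (hr : 0 < r) :
    ENNReal.ofReal |f r| ≤ ∫⁻ t in Set.Ioi r, ENNReal.ofReal |f' t| := by
  have hInt : ∀ x y : ℝ, 0 < x → 0 < y → IntervalIntegrable f' volume x y := by
    intro x y hx hy
    rw [intervalIntegrable_iff']
    refine hf'.integrableOn_compact_subset ?_ isCompact_uIcc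
    intro z hz
    exact lt_of_lt_of_le (lt_min hx hy) hz.1
  have h1 : ∀ᶠ R in atTop, ENNReal.ofReal |f r| ≤ ENNReal.ofReal |f R| + 
      ∫⁻ t in Set.Ioi r, ENNReal.ofReal |f' t| := by
    filter_upwards [eventually_gt_atTop r] with R hR
    have hR0 := hr.trans hR
    have e : f r = f R - ∫ t in r..R, f' t := by
      rw [hf r hr, hf R hR0, ← intervalIntegral.integral_add_adjacent_intervals
        (hInt 1 r one_pos hr) (hInt r R hr hR0)]
      ring
    have e2 : ENNReal.ofReal |∫ t in r..R, f' t| ≤ ∫⁻ t in Set.Ioi r, ENNReal.ofReal |f' t| := by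
      rw [intervalIntegral.integral_of_le hR.le, ← Real.norm_eq_abs, ofReal_norm]
      refine (enorm_integral_le_lintegral_enorm _).trans ?_
      simp_rw [← Real.norm_eq_abs, ofReal_norm]
      exact lintegral_mono_set Set.Ioc_subset_Ioi_self
    calc _ ≤ ENNReal.ofReal (|f R| + |∫ t in r..R, f' t|) := by
          refine ENNReal.ofReal_le_ofReal ?_
          rw [e]; exact abs_sub _ _
      _ ≤ ENNReal.ofReal |f R| + ENNReal.ofReal |∫ t in r..R, f' t| := ENNReal.ofReal_add_le
      _ ≤ _ := by gcongr
  have h2 : Tendsto (fun R => ENNReal.ofReal |f R| + 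
      ∫⁻ t in Set.Ioi r, ENNReal.ofReal |f' t|) atTop 
      (𝓝 (ENNReal.ofReal |0| + ∫⁻ t in Set.Ioi r, ENNReal.ofReal |f' t|)) := 
    (ENNReal.tendsto_ofReal hlim.abs).add tendsto_const_nhds
  simpa using ge_of_tendsto h2 h1

lemma exps5 {N : ℕ} (hN : 1 ≤ N) (p : ℝ) (hp : 1 ≤ p) (q : ℝ)
    (h : ENNReal.ofReal q ∈ (if p = (N : ℝ) / ((1:ℕ) : ℝ) ∧ 1 < N then Set.Ico (ENNReal.ofReal p) ⊤
  else if p < (N : ℝ) / ((1:ℕ) : ℝ) then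
    Set.Icc (ENNReal.ofReal p) (ENNReal.ofReal ((N : ℝ) * p / ((N : ℝ) - ((1:ℕ) : ℝ) * p)))
  else Set.Icc (ENNReal.ofReal p) ⊤)) : p ≤ q ∧ N ≤ N / q * p + p := by
  have hN' : (1:ℝ) ≤ N := by exact_mod_cast hN
  have hpq : ENNReal.ofReal p ≤ ENNReal.ofReal q → p ≤ q := by
    intro h
    by_contra! hlt
    exact absurd h (not_le.2 ((ENNReal.ofReal_lt_ofReal_iff (by linarith)).2 hlt))
  simp only [Nat.cast_one, div_one, one_mul] at h
  split_ifs at h with h1 h2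
  · have := hpq h.1
    refine ⟨this, ?_⟩
    have : 0 < q := by linarith
    have : 0 ≤ N / q * p := by positivity
    linarith [h1.1]
  · have h3 := hpq h.1
    refine ⟨h3, ?_⟩
    have h4 := h.2
    have hNp : 0 < (N:ℝ) - p := by linarith
    rw [ENNReal.ofReal_le_ofReal_iff (by positivity), le_div_iff₀ hNp] at h4
    have : 0 < q := by linarith
    have : N / q * p + p - N = (N * p - q * (N - p)) / q := by field_simp; ring
    have : 0 ≤ (N * p - q * (N - p)) / q := div_nonneg (by linarith) (by linarith)
    linarith
  · have := hpq h.1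
    refine ⟨this, ?_⟩
    have : 0 < q := by linarith
    have : 0 ≤ N / q * p := by positivity
    linarith

/-- Lemma 4(i). One-dimensional weighted Hardy inequality on `(0,∞)`
for `s < -1`, `1 ≤ p < ∞` and finite `q ∈ I_{1,p}`, for locally absolutely continuous
`f` with `f(r) → 0` as `r → ∞`. Local absolute continuity on `(0,∞)` is expressed by
`f r = f 1 + ∫_1^r f'` with `f'` locally integrable on `(0,∞)`. -/
theorem stmt_5 {N : ℕ} (hN : 1 ≤ N) (s p : ℝ) (hs : s < -1) (hp : 1 ≤ p) :
    ∀ q : ℝ, ENNReal.ofReal q ∈ Ijp N 1 p →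
      ∃ C : ℝ, 0 < C ∧
        ∀ f f' : ℝ → ℝ, LocallyIntegrableOn f' (Set.Ioi 0) volume →
          (∀ r : ℝ, 0 < r → f r = f 1 + ∫ t in (1:ℝ)..r, f' t) →
          Tendsto f atTop (nhds 0) →
          (∫⁻ r in Set.Ioi (0:ℝ),
              ENNReal.ofReal ((1 + r) ^ (-(s + 1) * q - N) * r ^ ((N : ℝ) - 1)
                * |f r| ^ q)) ^ (1 / q)
            ≤ ENNReal.ofReal C *
              (∫⁻ r in Set.Ioi (0:ℝ),
                ENNReal.ofReal ((1 + r) ^ (-s * p - N) * r ^ ((N : ℝ) - 1)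
                  * |f' r| ^ p)) ^ (1 / p) := by
  intro q hq
  obtain ⟨hpq, hcond⟩ := exps5 hN p hp q hq
  have hp0 : 0 < p := by linarith
  have hq0 : 0 < q := by linarith
  have hN' : (1:ℝ) ≤ N := by exact_mod_cast hN
  set a : ℝ := N / q with ha_def
  set S : ℝ := -(s+1) with hS_def
  have ha : 0 < a := by positivity
  have hS : 0 < S := by linarith
  have haq : a * q = N := by rw [ha_def]; field_simp
  have hhm : Measurable (h5 a S) := by unfold h5; fun_prop
  obtain ⟨C, hC, hmain⟩ := hardy5 (fun t => ENNReal.ofReal (h5 a S t)) (fun t => ENNReal.ofReal t)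
    (by fun_prop) (by fun_prop)
    (fun t ht => ⟨by simpa using h5_pos a S t ht, ENNReal.ofReal_ne_top⟩)
    (fun t ht => ⟨by simpa using ht, ENNReal.ofReal_ne_top⟩)
    (fun r t hr hrt => ENNReal.ofReal_le_ofReal (h5_mono a S ha hS r t hr hrt))
    (ENNReal.ofReal (1 / min a S)) ENNReal.ofReal_ne_top
    (fun r hr => h5_L1 a S ha hS r hr) (fun t ht => h5_L2 a S ha hS t ht) p q hp hpq
  refine ⟨(C ^ (1/q)).toReal + 1, by positivity, ?_⟩
  intro f f' hf' hf hlim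
  have hCle : C ^ (1/q) ≤ ENNReal.ofReal ((C ^ (1/q)).toReal + 1) := by
    rw [ENNReal.le_ofReal_iff_toReal_le (ENNReal.rpow_ne_top_of_nonneg (by positivity) hC)
      (by positivity)]
    linarith
  have hmeas : AEMeasurable f' (volume.restrict (Set.Ioi 0)) := hf'.aestronglyMeasurable.aemeasurable
  set g0 := hmeas.mk f' with hg0
  have hg0m : Measurable g0 := hmeas.measurable_mk
  have hae : f' =ᵐ[volume.restrict (Set.Ioi 0)] g0 := hmeas.ae_eq_mk
  have hM := hmain (fun t => ENNReal.ofReal |g0 t|) 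
    (by fun_prop)
  have hL : ∫⁻ r in Set.Ioi (0:ℝ), ENNReal.ofReal ((1 + r) ^ (-(s + 1) * q - N) * r ^ ((N : ℝ) - 1)
                * |f r| ^ q) ≤ ∫⁻ r in Set.Ioi 0, ENNReal.ofReal (h5 a S r) ^ q * (ENNReal.ofReal r)⁻¹ * 
          (∫⁻ t in Set.Ioi r, ENNReal.ofReal |g0 t|) ^ q := by
    refine setLIntegral_mono' measurableSet_Ioi fun r hr => ?_
    have hr' : (0:ℝ) < r := hr
    have e : (1 + r) ^ (-(s + 1) * q - N) * r ^ ((N : ℝ) - 1) = h5 a S r ^ q * r⁻¹ := by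
      unfold h5
      rw [Real.mul_rpow (by positivity) (by positivity), ← Real.rpow_mul hr'.le,
        ← Real.rpow_mul (by positivity), haq, sub_mul, haq, Real.rpow_sub_one hr'.ne']
      ring
    rw [e, ENNReal.ofReal_mul (by have := h5_pos a S r hr'; positivity),
      ENNReal.ofReal_mul (by have := h5_pos a S r hr'; positivity), 
      ← ENNReal.ofReal_rpow_of_nonneg (h5_pos a S r hr').le hq0.le,
      ← ENNReal.ofReal_rpow_of_nonneg (abs_nonneg _) hq0.le, ENNReal.ofReal_inv_of_pos hr']
    gcongr
    refine (tail5 f f' hf' hf hlim r hr').trans (le_of_eq ?_)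
    refine lintegral_congr_ae ?_
    filter_upwards [ae_restrict_of_ae_restrict_of_subset (Set.Ioi_subset_Ioi hr'.le) hae] with x hx
    rw [hx]
  have hR : ∫⁻ t in Set.Ioi 0, ENNReal.ofReal (h5 a S t) ^ p * ENNReal.ofReal t ^ (p-1) * 
        ENNReal.ofReal |g0 t| ^ p ≤ ∫⁻ r in Set.Ioi (0:ℝ),
                ENNReal.ofReal ((1 + r) ^ (-s * p - N) * r ^ ((N : ℝ) - 1)
                  * |f' r| ^ p) := by
    refine lintegral_mono_ae ?_
    filter_upwards [hae, ae_restrict_mem measurableSet_Ioi] with t ht1 ht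
    have ht' : (0:ℝ) < t := ht
    have hpos := h5_pos a S t ht'
    rw [← ht1, ENNReal.ofReal_rpow_of_nonneg hpos.le hp0.le, 
      ENNReal.ofReal_rpow_of_nonneg ht'.le (by linarith),
      ENNReal.ofReal_rpow_of_nonneg (abs_nonneg _) hp0.le, ← ENNReal.ofReal_mul (by positivity),
      ← ENNReal.ofReal_mul (by positivity)]
    refine ENNReal.ofReal_le_ofReal ?_
    refine mul_le_mul_of_nonneg_right ?_ (by positivity)
    have e : h5 a S t ^ p * t ^ (p-1) = (1 + t) ^ (-s * p - N) * t ^ ((N : ℝ) - 1) * 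
        (t / (1+t)) ^ (a * p + p - N) := by
      unfold h5
      rw [Real.mul_rpow (by positivity) (by positivity), ← Real.rpow_mul ht'.le,
        ← Real.rpow_mul (by positivity), Real.div_rpow ht'.le (by positivity), div_eq_mul_inv,
        ← Real.rpow_neg (by positivity)]
      have e1 : t ^ (a * p) * t ^ (p-1) = t ^ ((N:ℝ)-1) * t ^ (a*p+p-N) := by
        rw [← Real.rpow_add ht', ← Real.rpow_add ht']; congr 1; ring
      have e2 : (1+t) ^ ((S-a) * p) = (1+t) ^ (-s*p-N) * (1+t) ^ (-(a*p+p-N)) := by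
        rw [← Real.rpow_add (by positivity)]; congr 1; rw [hS_def]; ring
      rw [e2]
      linear_combination (1+t) ^ (-s*p-N) * (1+t) ^ (-(a*p+p-N)) * e1
    rw [e]
    refine mul_le_of_le_one_right (by positivity) (Real.rpow_le_one (by positivity) ?_ (by linarith))
    rw [div_le_one (by positivity)]; linarith
  calc _ ≤ (C * (∫⁻ r in Set.Ioi (0:ℝ), ENNReal.ofReal ((1 + r) ^ (-s * p - N) * r ^ ((N : ℝ) - 1)
                  * |f' r| ^ p)) ^ (q/p)) ^ (1/q) := by
        refine ENNReal.rpow_le_rpow ((hL.trans hM).trans ?_) (by positivity)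
        gcongr
    _ = C ^ (1/q) * (∫⁻ r in Set.Ioi (0:ℝ), ENNReal.ofReal ((1 + r) ^ (-s * p - N) * r ^ ((N : ℝ) - 1)
                  * |f' r| ^ p)) ^ (1/p) := by
        rw [ENNReal.mul_rpow_of_nonneg _ _ (by positivity), ← ENNReal.rpow_mul]
        congr 2
        field_simp
    _ ≤ _ := by gcongr

end
end
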